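/- The theory Ar + (AC!) is a subtheory of Ar + (Δ¹₁-C): the unique-choice scheme (AC!) is derivable in Ar extended with the Δ¹₁ comprehension scheme. -/

import Mathlib

namespace ArXiv150408062

/-! ### First-order arithmetic: numerical terms and arithmetical formulas -/

/-- Numerical terms, built from variables and the constants `0`, `1` by `+` and `·`. -/
inductive NTm where
  | var : ℕ → NTm
  | zero : NTm
  | one : NTm
  | add : NTm → NTm → NTm
  | mul : NTm → NTm → NTm
deriving DecidableEq

namespace NTm

def fv : NTm → Finset ℕ
  | .var i => {i}
  | .zero => ∅
  | .one => ∅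
  | .add t u => t.fv ∪ u.fv
  | .mul t u => t.fv ∪ u.fv

def maxVar : NTm → ℕ
  | .var i => i + 1
  | .zero => 0
  | .one => 0
  | .add t u => max t.maxVar u.maxVar
  | .mul t u => max t.maxVar u.maxVar

/-- Substitution of `u` for the variable `i`. -/
def subst (t : NTm) (i : ℕ) (u : NTm) : NTm :=
  match t with
  | .var j => if j = i then u else .var j
  | .zero => .zero
  | .one => .one
  | .add a b => .add (a.subst i u) (b.subst i u)
  | .mul a b => .mul (a.subst i u) (b.subst i u)

/-- Simultaneous substitution `σ` in a term. -/
def msubT (σ : ℕ → NTm) : NTm → NTm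
  | .var i => σ i
  | .zero => .zero
  | .one => .one
  | .add a b => .add (a.msubT σ) (b.msubT σ)
  | .mul a b => .mul (a.msubT σ) (b.msubT σ)

/-- Value of a term in the standard model under an evaluation of the variables. -/
def val (ρ : ℕ → ℕ) : NTm → ℕ
  | .var i => ρ i
  | .zero => 0
  | .one => 1
  | .add a b => a.val ρ + b.val ρ
  | .mul a b => a.val ρ * b.val ρ

/-- The numeral `n̄ = 1 + 1 + ⋯ + 1`. -/
def numN : ℕ → NTm
  | 0 => .zero
  | n + 1 => .add (numN n) .one

end NTm

/-- Purely arithmetical formulas (the formulas of PA). -/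
inductive AFm where
  | bot : AFm
  | eq : NTm → NTm → AFm
  | and : AFm → AFm → AFm
  | or : AFm → AFm → AFm
  | imp : AFm → AFm → AFm
  | all : ℕ → AFm → AFm
  | ex : ℕ → AFm → AFm
deriving DecidableEq

namespace AFm

def neg (φ : AFm) : AFm := φ.imp .bot
def iff (φ ψ : AFm) : AFm := (φ.imp ψ).and (ψ.imp φ)

def fv : AFm → Finset ℕ
  | .bot => ∅
  | .eq t u => t.fv ∪ u.fv
  | .and φ ψ => φ.fv ∪ ψ.fv
  | .or φ ψ => φ.fv ∪ ψ.fv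
  | .imp φ ψ => φ.fv ∪ ψ.fv
  | .all i φ => φ.fv.erase i
  | .ex i φ => φ.fv.erase i

/-- Capture-avoiding simultaneous substitution. -/
def msub (σ : ℕ → NTm) : AFm → AFm
  | .bot => .bot
  | .eq t u => .eq (t.msubT σ) (u.msubT σ)
  | .and φ ψ => .and (φ.msub σ) (ψ.msub σ)
  | .or φ ψ => .or (φ.msub σ) (ψ.msub σ)
  | .imp φ ψ => .imp (φ.msub σ) (ψ.msub σ)
  | .all i φ =>
      let j := (φ.fv.erase i).sup (fun v => (σ v).maxVar)
      .all j (φ.msub (Function.update σ i (.var j)))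
  | .ex i φ =>
      let j := (φ.fv.erase i).sup (fun v => (σ v).maxVar)
      .ex j (φ.msub (Function.update σ i (.var j)))

/-- Instantiation of the designated parameters `n₀, n₁, …` of a formula by a
list of terms. -/
def inst (α : AFm) (ts : List NTm) : AFm := α.msub (fun i => ts.getD i (.var i))

/-- Satisfaction in the standard model ℕ. -/
def sat (ρ : ℕ → ℕ) : AFm → Prop
  | .bot => False
  | .eq t u => t.val ρ = u.val ρ
  | .and φ ψ => φ.sat ρ ∧ ψ.sat ρ
  | .or φ ψ => φ.sat ρ ∨ ψ.sat ρ
  | .imp φ ψ => φ.sat ρ → ψ.sat ρ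
  | .all i φ => ∀ n : ℕ, φ.sat (Function.update ρ i n)
  | .ex i φ => ∃ n : ℕ, φ.sat (Function.update ρ i n)

end AFm

/-- The Peano axioms (with the parameters `n = n₀`, `m = n₁`). -/
inductive PeanoAx : AFm → Prop where
  | succ_ne_zero : PeanoAx ((AFm.eq (.add (.var 0) .one) .zero).neg)
  | succ_inj : PeanoAx ((AFm.eq (.add (.var 0) .one) (.add (.var 1) .one)).imp
      (.eq (.var 0) (.var 1)))
  | add_zero : PeanoAx (.eq (.add (.var 0) .zero) (.var 0))
  | add_succ : PeanoAx (.eq (.add (.var 0) (.add (.var 1) .one))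
      (.add (.add (.var 0) (.var 1)) .one))
  | mul_zero : PeanoAx (.eq (.mul (.var 0) .zero) .zero)
  | mul_succ : PeanoAx (.eq (.mul (.var 0) (.add (.var 1) .one))
      (.add (.mul (.var 0) (.var 1)) (.var 0)))

/-! ## The multi-sorted second-order arithmetic SA

The language of SA has variables over natural numbers and, for each sort
`k ≥ 1`, variables `x_i^{(k)}` over sets of natural numbers; constants `0, 1`,
functional symbols `+`, `·`, and predicate symbols `=` and `∈_k (k = 1, 2, …)`. -/

/-- Formulas of SA.  `mem k t i` is `t ∈_k x_i^{(k)}`; `allS k i φ` and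
`exS k i φ` quantify over the set variable `x_i^{(k)}` of sort `k`. -/
inductive SFm where
  | bot : SFm
  | eq : NTm → NTm → SFm
  | mem : ℕ → NTm → ℕ → SFm
  | and : SFm → SFm → SFm
  | or : SFm → SFm → SFm
  | imp : SFm → SFm → SFm
  | allN : ℕ → SFm → SFm
  | exN : ℕ → SFm → SFm
  | allS : ℕ → ℕ → SFm → SFm
  | exS : ℕ → ℕ → SFm → SFm
deriving DecidableEq

/-- Embedding of arithmetical formulas into the language of SA. -/
def AFm.toS : AFm → SFm
  | .bot => .bot
  | .eq t u => .eq t u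
  | .and φ ψ => .and φ.toS ψ.toS
  | .or φ ψ => .or φ.toS ψ.toS
  | .imp φ ψ => .imp φ.toS ψ.toS
  | .all i φ => .allN i φ.toS
  | .ex i φ => .exN i φ.toS

namespace SFm

def neg (φ : SFm) : SFm := φ.imp .bot
def iff (φ ψ : SFm) : SFm := (φ.imp ψ).and (ψ.imp φ)

/-- Free numerical variables. -/
def fvN : SFm → Finset ℕ
  | .bot => ∅
  | .eq t u => t.fv ∪ u.fv
  | .mem _ t _ => t.fv
  | .and φ ψ => φ.fvN ∪ ψ.fvN
  | .or φ ψ => φ.fvN ∪ ψ.fvN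
  | .imp φ ψ => φ.fvN ∪ ψ.fvN
  | .allN i φ => φ.fvN.erase i
  | .exN i φ => φ.fvN.erase i
  | .allS _ _ φ => φ.fvN
  | .exS _ _ φ => φ.fvN

/-- Free set variables, as pairs (sort, index). -/
def fvS : SFm → Finset (ℕ × ℕ)
  | .bot => ∅
  | .eq _ _ => ∅
  | .mem k _ i => {(k, i)}
  | .and φ ψ => φ.fvS ∪ ψ.fvS
  | .or φ ψ => φ.fvS ∪ ψ.fvS
  | .imp φ ψ => φ.fvS ∪ ψ.fvS
  | .allN _ φ => φ.fvS
  | .exN _ φ => φ.fvS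
  | .allS k i φ => φ.fvS.erase (k, i)
  | .exS k i φ => φ.fvS.erase (k, i)

/-- Substitution of a numerical term for the numerical variable `i` (naive). -/
def substN : SFm → ℕ → NTm → SFm
  | .bot, _, _ => .bot
  | .eq t u, i, w => .eq (t.subst i w) (u.subst i w)
  | .mem k t j, i, w => .mem k (t.subst i w) j
  | .and φ ψ, i, w => .and (φ.substN i w) (ψ.substN i w)
  | .or φ ψ, i, w => .or (φ.substN i w) (ψ.substN i w)
  | .imp φ ψ, i, w => .imp (φ.substN i w) (ψ.substN i w)
  | .allN j φ, i, w => if j = i then .allN j φ else .allN j (φ.substN i w)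
  | .exN j φ, i, w => if j = i then .exN j φ else .exN j (φ.substN i w)
  | .allS k j φ, i, w => .allS k j (φ.substN i w)
  | .exS k j φ, i, w => .exS k j (φ.substN i w)

/-- The numerical term `w` is substitutable for the numerical variable `i`. -/
def freeForN (w : NTm) (i : ℕ) : SFm → Prop
  | .and φ ψ => φ.freeForN w i ∧ ψ.freeForN w i
  | .or φ ψ => φ.freeForN w i ∧ ψ.freeForN w i
  | .imp φ ψ => φ.freeForN w i ∧ ψ.freeForN w i
  | .allN j φ => i ∉ (φ.fvN.erase j) ∨ (j ∉ w.fv ∧ φ.freeForN w i)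
  | .exN j φ => i ∉ (φ.fvN.erase j) ∨ (j ∉ w.fv ∧ φ.freeForN w i)
  | .allS _ _ φ => φ.freeForN w i
  | .exS _ _ φ => φ.freeForN w i
  | _ => True

/-- Substitution of the set variable `x_j^{(k)}` for the set variable
`x_i^{(k)}` (naive). -/
def substS : SFm → ℕ → ℕ → ℕ → SFm
  | .bot, _, _, _ => .bot
  | .eq t u, _, _, _ => .eq t u
  | .mem k' t i', k, i, j =>
      if k' = k ∧ i' = i then .mem k t j else .mem k' t i'
  | .and φ ψ, k, i, j => .and (φ.substS k i j) (ψ.substS k i j)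
  | .or φ ψ, k, i, j => .or (φ.substS k i j) (ψ.substS k i j)
  | .imp φ ψ, k, i, j => .imp (φ.substS k i j) (ψ.substS k i j)
  | .allN n φ, k, i, j => .allN n (φ.substS k i j)
  | .exN n φ, k, i, j => .exN n (φ.substS k i j)
  | .allS k' i' φ, k, i, j =>
      if k' = k ∧ i' = i then .allS k' i' φ else .allS k' i' (φ.substS k i j)
  | .exS k' i' φ, k, i, j =>
      if k' = k ∧ i' = i then .exS k' i' φ else .exS k' i' (φ.substS k i j)

/-- The set variable `x_j^{(k)}` is substitutable for `x_i^{(k)}`. -/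
def freeForS (k i j : ℕ) : SFm → Prop
  | .and φ ψ => φ.freeForS k i j ∧ ψ.freeForS k i j
  | .or φ ψ => φ.freeForS k i j ∧ ψ.freeForS k i j
  | .imp φ ψ => φ.freeForS k i j ∧ ψ.freeForS k i j
  | .allN _ φ => φ.freeForS k i j
  | .exN _ φ => φ.freeForS k i j
  | .allS k' i' φ => (k, i) ∉ (φ.fvS.erase (k', i')) ∨ ((k', i') ≠ (k, j) ∧ φ.freeForS k i j)
  | .exS k' i' φ => (k, i) ∉ (φ.fvS.erase (k', i')) ∨ ((k', i') ≠ (k, j) ∧ φ.freeForS k i j)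
  | _ => True

/-- Capture-avoiding simultaneous substitution of numerical terms for the
numerical variables. -/
def msubN (σ : ℕ → NTm) : SFm → SFm
  | .bot => .bot
  | .eq t u => .eq (t.msubT σ) (u.msubT σ)
  | .mem k t i => .mem k (t.msubT σ) i
  | .and φ ψ => .and (φ.msubN σ) (ψ.msubN σ)
  | .or φ ψ => .or (φ.msubN σ) (ψ.msubN σ)
  | .imp φ ψ => .imp (φ.msubN σ) (ψ.msubN σ)
  | .allN i φ =>
      let j := (φ.fvN.erase i).sup (fun v => (σ v).maxVar)
      .allN j (φ.msubN (Function.update σ i (.var j)))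
  | .exN i φ =>
      let j := (φ.fvN.erase i).sup (fun v => (σ v).maxVar)
      .exN j (φ.msubN (Function.update σ i (.var j)))
  | .allS k i φ => .allS k i (φ.msubN σ)
  | .exS k i φ => .exS k i (φ.msubN σ)

/-- `φ` is `k`-simple: no quantifiers over set variables and no variables of
sorts greater than `k`. -/
def simple (k : ℕ) : SFm → Prop
  | .bot => True
  | .eq _ _ => True
  | .mem j _ _ => j ≤ k
  | .and φ ψ => φ.simple k ∧ ψ.simple k
  | .or φ ψ => φ.simple k ∧ ψ.simple k
  | .imp φ ψ => φ.simple k ∧ ψ.simple k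
  | .allN _ φ => φ.simple k
  | .exN _ φ => φ.simple k
  | .allS _ _ _ => False
  | .exS _ _ _ => False

/-- `φ` has no quantifiers over set variables. -/
def noSetQ : SFm → Prop
  | .and φ ψ => φ.noSetQ ∧ ψ.noSetQ
  | .or φ ψ => φ.noSetQ ∧ ψ.noSetQ
  | .imp φ ψ => φ.noSetQ ∧ ψ.noSetQ
  | .allN _ φ => φ.noSetQ
  | .exN _ φ => φ.noSetQ
  | .allS _ _ _ => False
  | .exS _ _ _ => False
  | _ => True

/-- All sorts occurring in `φ` are `≤ s`. -/
def sortLE (s : ℕ∞) : SFm → Prop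
  | .bot => True
  | .eq _ _ => True
  | .mem k _ _ => (k : ℕ∞) ≤ s
  | .and φ ψ => φ.sortLE s ∧ ψ.sortLE s
  | .or φ ψ => φ.sortLE s ∧ ψ.sortLE s
  | .imp φ ψ => φ.sortLE s ∧ ψ.sortLE s
  | .allN _ φ => φ.sortLE s
  | .exN _ φ => φ.sortLE s
  | .allS k _ φ => (k : ℕ∞) ≤ s ∧ φ.sortLE s
  | .exS k _ φ => (k : ℕ∞) ≤ s ∧ φ.sortLE s

end SFm

/-- The formula `p = (n, m)` for the fixed (Cantor) numbering of pairs of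
natural numbers: `2·p = (n+m)·(n+m+1) + 2·m`. -/
def pairEq (p n m : NTm) : SFm :=
  .eq (.add p p) (.add (.mul (.add n m) (.add (.add n m) .one)) (.add m m))

/-- The Cantor pairing function on ℕ (the fixed numbering of pairs). -/
def cpair (n m : ℕ) : ℕ := (n + m) * (n + m + 1) / 2 + m

/-- `(n,m) ∈_k x_y^{(k)}`, i.e. `∃p(p = (n,m) ∧ p ∈_k x_y^{(k)})`. -/
def pairMem (k : ℕ) (n m : NTm) (y : ℕ) (p : ℕ) : SFm :=
  .exN p ((pairEq (.var p) n m).and (.mem k (.var p) y))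

/-! ### Axioms and derivability for SA -/

/-- The non-logical axioms of SA: Peano axioms, induction for all formulas,
comprehension for `k`-simple formulas, and the axiom of choice for `k`-simple
formulas. -/
inductive SAx : SFm → Prop where
  | peano {α : AFm} : PeanoAx α → SAx α.toS
  | ind (φ : SFm) (i : ℕ) :
      SAx (((φ.substN i .zero).and
        (.allN i (φ.imp (φ.substN i (.add (.var i) .one))))).imp (.allN i φ))
  | compr (k z j : ℕ) (φ : SFm) (h : φ.simple k) (hz : (k, z) ∉ φ.fvS) :
      SAx (.exS k z (.allN j ((SFm.mem k (.var j) z).iff φ)))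
  | choice (k : ℕ) (φ : SFm) (n ix iz iy q m p : ℕ)
      (h : φ.simple k)
      (hiz : (k, iz) ∉ φ.fvS) (hizx : iz ≠ ix)
      (hq : q ∉ φ.fvN ∧ q ≠ n) (hm : m ∉ φ.fvN ∧ m ≠ n)
      (hp : p ∉ φ.fvN ∧ p ≠ n ∧ p ≠ m) :
      SAx ((SFm.allN n (.exS k ix (φ.and (.allS k iz ((φ.substS k ix iz).imp
              (.allN q ((SFm.mem k (.var q) ix).iff (.mem k (.var q) iz)))))))).imp
           (.exS (k+1) iy (.allN n (.exS k ix (φ.and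
              (.allN m ((SFm.mem k (.var m) ix).iff
                (pairMem (k+1) (.var n) (.var m) iy p))))))))

/-- Logical axioms for the (classical, many-sorted) language of SA:
propositional axioms, double-negation elimination, quantifier axioms for
numerical and for set quantifiers, and equality axioms. -/
inductive SLogAx : SFm → Prop where
  | pl1 (φ ψ : SFm) : SLogAx (φ.imp (ψ.imp φ))
  | pl2 (φ ψ χ : SFm) : SLogAx ((φ.imp (ψ.imp χ)).imp ((φ.imp ψ).imp (φ.imp χ)))
  | pl3 (φ ψ : SFm) : SLogAx (φ.imp (ψ.imp (φ.and ψ)))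
  | pl4 (φ ψ : SFm) : SLogAx ((φ.and ψ).imp φ)
  | pl5 (φ ψ : SFm) : SLogAx ((φ.and ψ).imp ψ)
  | pl6 (φ ψ : SFm) : SLogAx (φ.imp (φ.or ψ))
  | pl7 (φ ψ : SFm) : SLogAx (ψ.imp (φ.or ψ))
  | pl8 (φ ψ χ : SFm) : SLogAx ((φ.imp χ).imp ((ψ.imp χ).imp ((φ.or ψ).imp χ)))
  | pl9 (φ : SFm) : SLogAx (SFm.bot.imp φ)
  | em (φ : SFm) : SLogAx ((φ.neg.neg).imp φ)
  | qa1 (i : ℕ) (φ : SFm) (t : NTm) (hf : φ.freeForN t i) :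
      SLogAx ((SFm.allN i φ).imp (φ.substN i t))
  | qa2 (i : ℕ) (φ : SFm) (t : NTm) (hf : φ.freeForN t i) :
      SLogAx ((φ.substN i t).imp (.exN i φ))
  | qa3 (k i j : ℕ) (φ : SFm) (hf : φ.freeForS k i j) :
      SLogAx ((SFm.allS k i φ).imp (φ.substS k i j))
  | qa4 (k i j : ℕ) (φ : SFm) (hf : φ.freeForS k i j) :
      SLogAx ((φ.substS k i j).imp (.exS k i φ))
  | eqRefl (t : NTm) : SLogAx (.eq t t)
  | eqSubst (i : ℕ) (t u : NTm) (φ : SFm)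
      (h1 : φ.freeForN t i) (h2 : φ.freeForN u i) :
      SLogAx ((SFm.eq t u).imp ((φ.substN i t).imp (φ.substN i u)))

/-- Derivability over the language of SA from logical axioms and a set `ax` of
non-logical axioms, with the language restriction `L`. -/
inductive SProvG (L : SFm → Prop) (ax : SFm → Prop) : SFm → Prop where
  | axm {φ : SFm} : SLogAx φ → L φ → SProvG L ax φ
  | extra {φ : SFm} : ax φ → L φ → SProvG L ax φ
  | mp {φ ψ : SFm} : SProvG L ax (φ.imp ψ) → SProvG L ax φ → SProvG L ax ψ
  | allRN {ψ : SFm} {i : ℕ} {φ : SFm} : SProvG L ax (ψ.imp φ) → i ∉ ψ.fvN →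
      L (.allN i φ) → SProvG L ax (ψ.imp (.allN i φ))
  | exRN {ψ : SFm} {i : ℕ} {φ : SFm} : SProvG L ax (φ.imp ψ) → i ∉ ψ.fvN →
      L (.exN i φ) → SProvG L ax ((SFm.exN i φ).imp ψ)
  | allRS {ψ : SFm} {k i : ℕ} {φ : SFm} : SProvG L ax (ψ.imp φ) → (k, i) ∉ ψ.fvS →
      L (.allS k i φ) → SProvG L ax (ψ.imp (.allS k i φ))
  | exRS {ψ : SFm} {k i : ℕ} {φ : SFm} : SProvG L ax (φ.imp ψ) → (k, i) ∉ ψ.fvS →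
      L (.exS k i φ) → SProvG L ax ((SFm.exS k i φ).imp ψ)

/-- Derivability in (the fragment with sorts `≤ s` of) the multi-sorted
second-order arithmetic SA; `SAProv ⊤` is derivability in full SA, `SAProv s`
(for `s : ℕ`) is derivability in the fragment `SA_s` (`SA_0 = PA`). -/
def SAProv (s : ℕ∞) : SFm → Prop := SProvG (fun φ => φ.sortLE s) SAx

/-! ## The predicative second-order arithmetic Ar and its extensions

Ar has one sort of set variables; we render its formulas as the formulas of SA
in which all set variables and membership predicates have sort 1. -/

/-- The non-logical axioms of Ar: Peano axioms, induction for all formulas and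
comprehension for formulas without quantifiers over set variables. -/
inductive ArAx : SFm → Prop where
  | peano {α : AFm} : PeanoAx α → ArAx α.toS
  | ind (φ : SFm) (i : ℕ) :
      ArAx (((φ.substN i .zero).and
        (.allN i (φ.imp (φ.substN i (.add (.var i) .one))))).imp (.allN i φ))
  | compr (z j : ℕ) (φ : SFm) (h : φ.noSetQ) (hz : (1, z) ∉ φ.fvS) :
      ArAx (.exS 1 z (.allN j ((SFm.mem 1 (.var j) z).iff φ)))

/-- The unique-choice scheme (AC!):
`∀k∃!x φ(k,x) ⊃ ∃y∀k∃x[φ(k,x) ∧ ∀m(m ∈ x ≡ (k,m) ∈ y)]`,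
for `φ` without quantifiers over set variables and not containing `y`
(with `∃!x φ` expanded using the defined set equality `∀q(q∈x ≡ q∈z)`). -/
inductive ACBang : SFm → Prop where
  | intro (φ : SFm) (n ix iz iy q m p : ℕ)
      (h : φ.noSetQ)
      (hiz : (1, iz) ∉ φ.fvS) (hizx : iz ≠ ix)
      (hiy : (1, iy) ∉ φ.fvS) (hiyx : iy ≠ ix) (hiyz : iy ≠ iz)
      (hq : q ∉ φ.fvN ∧ q ≠ n) (hm : m ∉ φ.fvN ∧ m ≠ n)
      (hp : p ∉ φ.fvN ∧ p ≠ n ∧ p ≠ m) :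
      ACBang ((SFm.allN n (.exS 1 ix (φ.and (.allS 1 iz ((φ.substS 1 ix iz).imp
          (.allN q ((SFm.mem 1 (.var q) ix).iff (.mem 1 (.var q) iz)))))))).imp
        (.exS 1 iy (.allN n (.exS 1 ix (φ.and
          (.allN m ((SFm.mem 1 (.var m) ix).iff
            (pairMem 1 (.var n) (.var m) iy p))))))))

/-- The `Δ¹₁`-comprehension scheme (Δ¹₁-C):
`∀n[∀v φ(n,v) ≡ ∃u ψ(n,u)] ⊃ ∃z∀n[n ∈ z ≡ ∃u ψ(n,u)]`,
where `φ` and `ψ` have no quantifiers over set variables and do not contain `z`. -/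
inductive DeltaC : SFm → Prop where
  | intro (φ ψ : SFm) (n iv iu iz : ℕ)
      (hφ : φ.noSetQ) (hψ : ψ.noSetQ)
      (hz1 : (1, iz) ∉ φ.fvS) (hz2 : (1, iz) ∉ ψ.fvS)
      (hzu : iz ≠ iu) (hzv : iz ≠ iv) :
      DeltaC ((SFm.allN n ((SFm.allS 1 iv φ).iff (.exS 1 iu ψ))).imp
        (.exS 1 iz (.allN n ((SFm.mem 1 (.var n) iz).iff (.exS 1 iu ψ)))))

/-- Derivability in Ar extended by the scheme `extra` (over the one-sorted
language: all set sorts are `= 1`). -/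
def ArProv (extra : SFm → Prop) : SFm → Prop :=
  SProvG (fun φ => φ.sortLE 1) (fun φ => ArAx φ ∨ extra φ)

/-- The interpretation `φ ↦ φ^∧` of SA in Ar: all sorts are removed and the set
variable `x_i^{(k)}` is renamed into `x_{(k,i)}`. -/
def hatTr : SFm → SFm
  | .bot => .bot
  | .eq t u => .eq t u
  | .mem k t i => .mem 1 t (Nat.pair k i)
  | .and φ ψ => .and (hatTr φ) (hatTr ψ)
  | .or φ ψ => .or (hatTr φ) (hatTr ψ)
  | .imp φ ψ => .imp (hatTr φ) (hatTr ψ)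
  | .allN i φ => .allN i (hatTr φ)
  | .exN i φ => .exN i (hatTr φ)
  | .allS k i φ => .allS 1 (Nat.pair k i) (hatTr φ)
  | .exS k i φ => .exS 1 (Nat.pair k i) (hatTr φ)

/-! ### Eliminating the restriction on sorts -/

/-- Replaces atoms of sorts greater than `1` by `⊥` and drops quantifiers over such sorts. -/
def SFm.collapse : SFm → SFm
  | .bot => .bot
  | .eq t u => .eq t u
  | .mem k t i => if k ≤ 1 then .mem k t i else .bot
  | .and φ ψ => .and φ.collapse ψ.collapse
  | .or φ ψ => .or φ.collapse ψ.collapse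
  | .imp φ ψ => .imp φ.collapse ψ.collapse
  | .allN i φ => .allN i φ.collapse
  | .exN i φ => .exN i φ.collapse
  | .allS k i φ => if k ≤ 1 then .allS k i φ.collapse else φ.collapse
  | .exS k i φ => if k ≤ 1 then .exS k i φ.collapse else φ.collapse

namespace SFm

theorem collapse_eq_self {φ : SFm} (h : φ.sortLE 1) : φ.collapse = φ := by
  induction φ <;> simp_all [collapse, sortLE]

theorem sortLE_collapse (φ : SFm) : φ.collapse.sortLE 1 := by
  induction φ <;> simp_all [collapse, sortLE]
  all_goals split_ifs <;> simp_all [sortLE]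

theorem collapse_substN (φ : SFm) (i : ℕ) (t : NTm) :
    (φ.substN i t).collapse = φ.collapse.substN i t := by
  induction φ <;> simp_all [collapse, substN]
  all_goals split_ifs <;> simp_all [collapse, substN]

theorem fvN_collapse (φ : SFm) : φ.collapse.fvN ⊆ φ.fvN := by
  induction φ <;> simp_all [collapse, fvN]
  all_goals first
    | (split_ifs <;> simp_all [fvN])
    | exact Finset.union_subset_union ‹_› ‹_›
    | exact Finset.erase_subset_erase _ ‹_›

theorem fvS_collapse (φ : SFm) : φ.collapse.fvS ⊆ φ.fvS.filter (fun v => v.1 ≤ 1) := by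
  intro v
  induction φ with
  | bot => simp [collapse, fvS]
  | eq => simp [collapse, fvS]
  | mem k t i =>
    simp only [collapse]
    split_ifs with h
    · simp only [fvS, Finset.mem_singleton, Finset.mem_filter]
      rintro rfl
      exact ⟨rfl, h⟩
    · simp [fvS]
  | and φ ψ h1 h2 => simp_all [collapse, fvS]; grind
  | or φ ψ h1 h2 => simp_all [collapse, fvS]; grind
  | imp φ ψ h1 h2 => simp_all [collapse, fvS]; grind
  | allN i φ h => simpa [collapse, fvS] using h
  | exN i φ h => simpa [collapse, fvS] using h
  | allS k i φ h => simp only [collapse]; split_ifs <;> simp_all [fvS]; grind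
  | exS k i φ h => simp only [collapse]; split_ifs <;> simp_all [fvS]; grind

theorem noSetQ.collapse {φ : SFm} (h : φ.noSetQ) : φ.collapse.noSetQ := by
  induction φ <;> simp_all [SFm.collapse, noSetQ]
  split_ifs <;> simp_all [noSetQ]

theorem freeForN.collapse {φ : SFm} {t : NTm} {i : ℕ} (h : φ.freeForN t i) :
    φ.collapse.freeForN t i := by
  induction φ with
  | allN j φ ih => 
    have := fvN_collapse φ
    simp_all [SFm.collapse, freeForN]; grind
  | exN j φ ih =>
    have := fvN_collapse φ
    simp_all [SFm.collapse, freeForN]; grind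
  | mem => simp only [SFm.collapse]; split_ifs <;> simp [freeForN]
  | allS => simp only [SFm.collapse]; split_ifs <;> simp_all [freeForN]
  | exS => simp only [SFm.collapse]; split_ifs <;> simp_all [freeForN]
  | _ => simp_all [SFm.collapse, freeForN]

theorem freeForS_of_notMem {φ : SFm} {k i : ℕ} (j : ℕ) (h : (k, i) ∉ φ.fvS) :
    φ.freeForS k i j := by
  induction φ <;> simp_all [fvS, freeForS]

theorem freeForS.collapse {φ : SFm} {k i j : ℕ} (h : φ.freeForS k i j) :
    φ.collapse.freeForS k i j := by
  have aux (φ : SFm) (k' i' : ℕ) (h : (k, i) ∉ φ.fvS.erase (k', i') ∨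
      ((k', i') ≠ (k, j) ∧ φ.freeForS k i j)) (hk : ¬ k' ≤ 1)
      (ih : φ.freeForS k i j → φ.collapse.freeForS k i j) : φ.collapse.freeForS k i j := by
    rcases h with h | h
    · apply freeForS_of_notMem
      intro hm
      have := fvS_collapse φ hm
      simp only [Finset.mem_filter, Finset.mem_erase] at this h
      grind
    · exact ih h.2
  induction φ with
  | allS k' i' φ ih =>
    have := fvS_collapse φ
    simp only [SFm.collapse]
    split_ifs with hk
    · simp_all only [freeForS, Finset.mem_erase]; grind
    · exact aux φ k' i' h hk ih
  | exS k' i' φ ih =>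
    have := fvS_collapse φ
    simp only [SFm.collapse]
    split_ifs with hk
    · simp_all only [freeForS, Finset.mem_erase]; grind
    · exact aux φ k' i' h hk ih
  | mem => simp only [SFm.collapse]; split_ifs <;> simp [freeForS]
  | _ => simp_all [SFm.collapse, freeForS]

theorem collapse_substS {φ : SFm} {k i j : ℕ} (hk : k ≤ 1) :
    (φ.substS k i j).collapse = φ.collapse.substS k i j := by
  induction φ <;> simp_all [collapse, substS]
  all_goals split_ifs <;> simp_all [collapse, substS]

theorem collapse_substS_of_lt {φ : SFm} {k i j : ℕ} (hk : ¬ k ≤ 1) :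
    (φ.substS k i j).collapse = φ.collapse := by
  induction φ <;> simp_all [collapse, substS]
  all_goals split_ifs <;> simp_all [collapse]
  omega

end SFm

theorem SLogAx.collapse {φ : SFm} (h : SLogAx φ) (ax : SFm → Prop) :
    SProvG (fun φ => φ.sortLE 1) ax φ.collapse := by
  have key {ψ : SFm} (h : SLogAx ψ.collapse) : SProvG (fun φ => φ.sortLE 1) ax ψ.collapse :=
    .axm h ψ.sortLE_collapse
  have triv (ψ : SFm) (hψ : ψ.sortLE 1) : SProvG (fun φ => φ.sortLE 1) ax (ψ.imp ψ) := by
    refine .mp (.mp (.axm (.pl2 ψ (ψ.imp ψ) ψ) ?_) (.axm (.pl1 _ _) ?_)) (.axm (.pl1 _ _) ?_) <;>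
      simp [SFm.sortLE, hψ]
  induction h with
  | pl1 φ ψ => exact key (.pl1 _ _)
  | pl2 φ ψ χ => exact key (.pl2 _ _ _)
  | pl3 φ ψ => exact key (.pl3 _ _)
  | pl4 φ ψ => exact key (.pl4 _ _)
  | pl5 φ ψ => exact key (.pl5 _ _)
  | pl6 φ ψ => exact key (.pl6 _ _)
  | pl7 φ ψ => exact key (.pl7 _ _)
  | pl8 φ ψ χ => exact key (.pl8 _ _ _)
  | pl9 φ => exact key (.pl9 _)
  | em φ => exact key (.em _)
  | qa1 i φ t hf =>
    refine key ?_
    simp only [SFm.collapse, SFm.collapse_substN]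
    exact .qa1 _ _ _ hf.collapse
  | qa2 i φ t hf =>
    refine key ?_
    simp only [SFm.collapse, SFm.collapse_substN]
    exact .qa2 _ _ _ hf.collapse
  | qa3 k i j φ hf =>
    by_cases hk : k ≤ 1
    · refine key ?_
      simp only [SFm.collapse, hk, if_true, SFm.collapse_substS hk]
      exact .qa3 _ _ _ _ hf.collapse
    · simp only [SFm.collapse, hk, if_false, SFm.collapse_substS_of_lt hk]
      exact triv _ φ.sortLE_collapse
  | qa4 k i j φ hf =>
    by_cases hk : k ≤ 1
    · refine key ?_
      simp only [SFm.collapse, hk, if_true, SFm.collapse_substS hk]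
      exact .qa4 _ _ _ _ hf.collapse
    · simp only [SFm.collapse, hk, if_false, SFm.collapse_substS_of_lt hk]
      exact triv _ φ.sortLE_collapse
  | eqRefl t => exact key (.eqRefl _)
  | eqSubst i t u φ h1 h2 =>
    refine key ?_
    simp only [SFm.collapse, SFm.collapse_substN]
    exact .eqSubst _ _ _ _ h1.collapse h2.collapse

theorem collapse_toS (α : AFm) : α.toS.collapse = α.toS := by
  induction α <;> simp_all [AFm.toS, SFm.collapse]

theorem SFm.notMem_fvS_collapse {φ : SFm} {v : ℕ × ℕ} (h : v ∉ φ.fvS) : v ∉ φ.collapse.fvS :=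
  fun h' => h (Finset.mem_of_mem_filter _ (fvS_collapse φ h'))

theorem ArAx.collapse {φ : SFm} (h : ArAx φ) : ArAx φ.collapse := by
  induction h with
  | peano h => rw [collapse_toS]; exact .peano h
  | ind φ i =>
    simp only [SFm.collapse, SFm.collapse_substN]
    exact .ind _ _
  | compr z j φ h hz =>
    exact .compr _ _ _ h.collapse (SFm.notMem_fvS_collapse hz)

theorem DeltaC.collapse {φ : SFm} (h : DeltaC φ) : DeltaC φ.collapse := by
  induction h with
  | intro φ ψ n iv iu iz hφ hψ hz1 hz2 hzu hzv =>
    exact .intro _ _ _ _ _ _ hφ.collapse hψ.collapse (SFm.notMem_fvS_collapse hz1)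
      (SFm.notMem_fvS_collapse hz2) hzu hzv

/-- Derivability in `Ar + (Δ¹₁-C)` with formulas of arbitrary sorts allowed. -/
abbrev Prov (φ : SFm) : Prop := SProvG (fun _ => True) (fun φ => ArAx φ ∨ DeltaC φ) φ

theorem Prov.collapse {φ : SFm} (h : Prov φ) : ArProv DeltaC φ.collapse := by
  induction h with
  | axm h _ => exact h.collapse _
  | extra h _ => exact .extra (h.imp ArAx.collapse DeltaC.collapse) (SFm.sortLE_collapse _)
  | mp _ _ h1 h2 => exact .mp h1 h2
  | allRN _ hi _ h =>
    exact .allRN h (fun h' => hi (SFm.fvN_collapse _ h')) (SFm.sortLE_collapse (.allN _ _))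
  | exRN _ hi _ h =>
    exact .exRN h (fun h' => hi (SFm.fvN_collapse _ h')) (SFm.sortLE_collapse (.exN _ _))
  | @allRS ψ k i φ _ hi _ h =>
    by_cases hk : k ≤ 1
    · simp only [SFm.collapse, hk, if_true] at h ⊢
      have := SFm.sortLE_collapse (.allS k i φ)
      simp only [SFm.collapse, hk, if_true] at this
      exact .allRS h (SFm.notMem_fvS_collapse hi) this
    · simpa only [SFm.collapse, hk, if_false] using h
  | @exRS ψ k i φ _ hi _ h =>
    by_cases hk : k ≤ 1
    · simp only [SFm.collapse, hk, if_true] at h ⊢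
      have := SFm.sortLE_collapse (.exS k i φ)
      simp only [SFm.collapse, hk, if_true] at this
      exact .exRS h (SFm.notMem_fvS_collapse hi) this
    · simpa only [SFm.collapse, hk, if_false] using h

/-! ### Natural deduction -/

/-- Conjunction of a list of formulas. -/
def conj : List SFm → SFm
  | [] => SFm.bot.imp .bot
  | φ :: Γ => φ.and (conj Γ)

theorem notMem_fvN_conj {Γ : List SFm} {i : ℕ} (h : ∀ γ ∈ Γ, i ∉ γ.fvN) : i ∉ (conj Γ).fvN := by
  induction Γ <;> simp_all [conj, SFm.fvN]

theorem notMem_fvS_conj {Γ : List SFm} {v : ℕ × ℕ} (h : ∀ γ ∈ Γ, v ∉ γ.fvS) :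
    v ∉ (conj Γ).fvS := by
  induction Γ <;> simp_all [conj, SFm.fvS]

namespace Prov

variable {φ ψ χ : SFm}

theorem logic (h : SLogAx φ) : Prov φ := .axm h trivial

theorem weaken (h : Prov φ) : Prov (ψ.imp φ) := .mp (logic (.pl1 _ _)) h

theorem mp₁ (h : Prov (χ.imp (φ.imp ψ))) (h' : Prov (χ.imp φ)) : Prov (χ.imp ψ) :=
  .mp (.mp (logic (.pl2 _ _ _)) h) h'

theorem trans (h : Prov (φ.imp ψ)) (h' : Prov (ψ.imp χ)) : Prov (φ.imp χ) :=
  mp₁ h'.weaken h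

theorem refl (φ : SFm) : Prov (φ.imp φ) := mp₁ (logic (.pl1 φ (φ.imp φ))) (logic (.pl1 φ φ))

theorem curry (h : Prov ((φ.and ψ).imp χ)) : Prov (ψ.imp (φ.imp χ)) := by
  have h1 : Prov (ψ.imp (φ.imp (φ.and ψ))) := by
    have h2 : Prov (φ.imp (ψ.imp (φ.and ψ))) := logic (.pl3 _ _)
    have h3 : Prov (ψ.imp (φ.imp (ψ.imp (φ.and ψ)))) := h2.weaken
    have h4 : Prov (ψ.imp ((φ.imp ψ).imp (φ.imp (φ.and ψ)))) :=
      trans h3 (logic (.pl2 _ _ _))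
    exact mp₁ h4 (logic (.pl1 _ _))
  have h5 : Prov (ψ.imp (φ.imp ((φ.and ψ).imp χ))) := h.weaken.weaken
  exact mp₁ (trans h5 (logic (.pl2 _ _ _))) h1

theorem uncurry (h : Prov (ψ.imp (φ.imp χ))) : Prov ((φ.and ψ).imp χ) :=
  mp₁ (trans (logic (.pl5 _ _)) h) (logic (.pl4 _ _))

theorem swap (h : Prov (φ.imp (ψ.imp χ))) : Prov (ψ.imp (φ.imp χ)) :=
  curry (trans (mp₁ (mp₁ (weaken (logic (.pl3 ψ φ))) (logic (.pl5 φ ψ))) (logic (.pl4 _ _)))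
    (uncurry h))

end Prov

/-- Derivability of `φ` from the hypotheses `Γ`. -/
def Ded (Γ : List SFm) (φ : SFm) : Prop := Prov ((conj Γ).imp φ)

namespace Ded

variable {Γ Δ : List SFm} {φ ψ χ : SFm}

theorem ofProv (h : Prov φ) : Ded Γ φ := h.weaken

theorem logic (h : SLogAx φ) : Ded Γ φ := ofProv (.logic h)

theorem toProv (h : Ded [] φ) : Prov φ := .mp h (Prov.refl _)

theorem mp (h : Ded Γ (φ.imp ψ)) (h' : Ded Γ φ) : Ded Γ ψ := Prov.mp₁ h h'

theorem hyp (h : φ ∈ Γ) : Ded Γ φ := by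
  induction Γ with
  | nil => simp at h
  | cons γ Γ ih =>
    rcases List.mem_cons.1 h with rfl | h
    · exact Prov.logic (.pl4 _ _)
    · exact Prov.trans (.logic (.pl5 _ _)) (ih h)

theorem impI (h : Ded (φ :: Γ) ψ) : Ded Γ (φ.imp ψ) := Prov.curry h

theorem mono (h : Ded Γ φ) (hs : Γ ⊆ Δ) : Ded Δ φ := by
  refine Prov.trans ?_ h
  clear h
  change Ded Δ (conj Γ)
  induction Γ with
  | nil => exact ofProv (Prov.refl _)
  | cons γ Γ ih =>
    exact mp (mp (logic (.pl3 _ _)) (hyp (hs (by simp))))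
      (ih fun x hx => hs (List.mem_cons_of_mem _ hx))

theorem wk (h : Ded Γ φ) : Ded (ψ :: Γ) φ := h.mono (List.subset_cons_self _ _)

theorem cut (h : Ded Γ φ) (h' : Ded (φ :: Γ) ψ) : Ded Γ ψ := mp (impI h') h

theorem andI (h : Ded Γ φ) (h' : Ded Γ ψ) : Ded Γ (φ.and ψ) := mp (mp (logic (.pl3 _ _)) h) h'

theorem andL (h : Ded Γ (φ.and ψ)) : Ded Γ φ := mp (logic (.pl4 _ _)) h

theorem andR (h : Ded Γ (φ.and ψ)) : Ded Γ ψ := mp (logic (.pl5 _ _)) h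

theorem iffI (h : Ded (φ :: Γ) ψ) (h' : Ded (ψ :: Γ) φ) : Ded Γ (φ.iff ψ) :=
  andI (impI h) (impI h')

theorem orL (h : Ded Γ φ) : Ded Γ (φ.or ψ) := mp (logic (.pl6 _ _)) h

theorem orR (h : Ded Γ ψ) : Ded Γ (φ.or ψ) := mp (logic (.pl7 _ _)) h

theorem orE (h : Ded Γ (φ.or ψ)) (h1 : Ded (φ :: Γ) χ) (h2 : Ded (ψ :: Γ) χ) : Ded Γ χ :=
  mp (mp (mp (logic (.pl8 _ _ _)) (impI h1)) (impI h2)) h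

theorem botE (h : Ded Γ .bot) : Ded Γ φ := mp (logic (.pl9 _)) h

theorem allNI {i : ℕ} (h : Ded Γ φ) (hi : ∀ γ ∈ Γ, i ∉ γ.fvN) : Ded Γ (.allN i φ) :=
  .allRN h (notMem_fvN_conj hi) trivial

theorem allSI {k i : ℕ} (h : Ded Γ φ) (hi : ∀ γ ∈ Γ, (k, i) ∉ γ.fvS) : Ded Γ (.allS k i φ) :=
  .allRS h (notMem_fvS_conj hi) trivial

theorem allNE {i : ℕ} {t : NTm} (h : Ded Γ (.allN i φ)) (hf : φ.freeForN t i) :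
    Ded Γ (φ.substN i t) :=
  mp (logic (.qa1 _ _ _ hf)) h

theorem allSE {k i j : ℕ} (h : Ded Γ (.allS k i φ)) (hf : φ.freeForS k i j) :
    Ded Γ (φ.substS k i j) :=
  mp (logic (.qa3 _ _ _ _ hf)) h

theorem exNI {i : ℕ} {t : NTm} (h : Ded Γ (φ.substN i t)) (hf : φ.freeForN t i) :
    Ded Γ (.exN i φ) :=
  mp (logic (.qa2 _ _ _ hf)) h

theorem exSI {k i j : ℕ} (h : Ded Γ (φ.substS k i j)) (hf : φ.freeForS k i j) :
    Ded Γ (.exS k i φ) :=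
  mp (logic (.qa4 _ _ _ _ hf)) h

theorem exNE {i : ℕ} (h : Ded Γ (.exN i φ)) (h' : Ded (φ :: Γ) χ) (hχ : i ∉ χ.fvN)
    (hi : ∀ γ ∈ Γ, i ∉ γ.fvN) : Ded Γ χ := by
  have h1 : Prov (φ.imp ((conj Γ).imp χ)) := Prov.swap (Prov.curry h')
  have h2 : Prov ((SFm.exN i φ).imp ((conj Γ).imp χ)) :=
    .exRN h1 (by simpa [SFm.fvN] using ⟨notMem_fvN_conj hi, hχ⟩) trivial
  exact mp (mp (ofProv h2) h) (Prov.refl _)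

theorem exSE {k i : ℕ} (h : Ded Γ (.exS k i φ)) (h' : Ded (φ :: Γ) χ) (hχ : (k, i) ∉ χ.fvS)
    (hi : ∀ γ ∈ Γ, (k, i) ∉ γ.fvS) : Ded Γ χ := by
  have h1 : Prov (φ.imp ((conj Γ).imp χ)) := Prov.swap (Prov.curry h')
  have h2 : Prov ((SFm.exS k i φ).imp ((conj Γ).imp χ)) :=
    .exRS h1 (by simpa [SFm.fvS] using ⟨notMem_fvS_conj hi, hχ⟩) trivial
  exact mp (mp (ofProv h2) h) (Prov.refl _)

end Ded

/-! ### Equality and arithmetic -/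

namespace NTm

theorem subst_of_notMem {t : NTm} {i : ℕ} (u : NTm) (h : i ∉ t.fv) : t.subst i u = t := by
  induction t <;> simp_all [subst, fv]
  grind

theorem exists_notMem_fv (t u v : NTm) : ∃ i, i ∉ t.fv ∧ i ∉ u.fv ∧ i ∉ v.fv := by
  obtain ⟨i, hi⟩ := Infinite.exists_notMem_finset (t.fv ∪ u.fv ∪ v.fv)
  exact ⟨i, by simpa [and_assoc] using hi⟩

end NTm

namespace Ded

variable {Γ : List SFm}

theorem eqRefl (t : NTm) : Ded Γ (.eq t t) := logic (.eqRefl t)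

/-- Replacement of equals by equals. -/
theorem eqRw {t u : NTm} {φ : SFm} (i : ℕ) (h : Ded Γ (.eq t u)) (h' : Ded Γ (φ.substN i t))
    (ht : φ.freeForN t i) (hu : φ.freeForN u i) : Ded Γ (φ.substN i u) :=
  mp (mp (logic (.eqSubst i t u φ ht hu)) h) h'

/-- Congruence for term contexts with the hole `i`. -/
theorem eqCongr {t u : NTm} (c : NTm) (i : ℕ) (h : Ded Γ (.eq t u)) :
    Ded Γ (.eq (c.subst i t) (c.subst i u)) := by
  obtain ⟨j, hc, ht, hu⟩ := NTm.exists_notMem_fv (c.subst i t) (.add c t) u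
  have hs (v : NTm) : (c.subst i (.var j)).subst j v = c.subst i v := by
    have : j ∉ c.fv := by simp_all [NTm.fv]
    clear hc
    induction c <;> simp_all [NTm.subst, NTm.fv]
    split_ifs <;> simp [NTm.subst]
    grind
  have := eqRw (φ := .eq (c.subst i t) (c.subst i (.var j))) j h
    (by simpa [SFm.substN, hs, NTm.subst_of_notMem _ hc] using eqRefl _)
    (by simp [SFm.freeForN]) (by simp [SFm.freeForN])
  simpa [SFm.substN, hs, NTm.subst_of_notMem _ hc] using this

theorem eqSymm {t u : NTm} (h : Ded Γ (.eq t u)) : Ded Γ (.eq u t) := by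
  obtain ⟨j, ht, -, -⟩ := NTm.exists_notMem_fv t t t
  have := eqRw (φ := .eq (.var j) t) j h
    (by simpa [SFm.substN, NTm.subst, NTm.subst_of_notMem _ ht] using eqRefl _)
    (by simp [SFm.freeForN]) (by simp [SFm.freeForN])
  simpa [SFm.substN, NTm.subst, NTm.subst_of_notMem _ ht] using this

theorem eqTrans {t u v : NTm} (h : Ded Γ (.eq t u)) (h' : Ded Γ (.eq u v)) :
    Ded Γ (.eq t v) := by
  obtain ⟨j, ht, -, -⟩ := NTm.exists_notMem_fv t t t
  have := eqRw (φ := .eq t (.var j)) j h'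
    (by simpa [SFm.substN, NTm.subst, NTm.subst_of_notMem _ ht] using h)
    (by simp [SFm.freeForN]) (by simp [SFm.freeForN])
  simpa [SFm.substN, NTm.subst, NTm.subst_of_notMem _ ht] using this

theorem eqAdd {t u t' u' : NTm} (h : Ded Γ (.eq t u)) (h' : Ded Γ (.eq t' u')) :
    Ded Γ (.eq (.add t t') (.add u u')) := by
  obtain ⟨j, ht, hu, -⟩ := NTm.exists_notMem_fv t' u u
  refine eqTrans (u := .add u t') ?_ ?_
  · simpa [NTm.subst, NTm.subst_of_notMem _ ht] using eqCongr (.add (.var j) t') j h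
  · simpa [NTm.subst, NTm.subst_of_notMem _ hu] using eqCongr (.add u (.var j)) j h'

theorem eqMul {t u t' u' : NTm} (h : Ded Γ (.eq t u)) (h' : Ded Γ (.eq t' u')) :
    Ded Γ (.eq (.mul t t') (.mul u u')) := by
  obtain ⟨j, ht, hu, -⟩ := NTm.exists_notMem_fv t' u u
  refine eqTrans (u := .mul u t') ?_ ?_
  · simpa [NTm.subst, NTm.subst_of_notMem _ ht] using eqCongr (.mul (.var j) t') j h
  · simpa [NTm.subst, NTm.subst_of_notMem _ hu] using eqCongr (.mul u (.var j)) j h'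

/-- Substitution into theorems without quantifiers. -/
theorem substN {φ : SFm} (i : ℕ) (t : NTm) (h : Ded [] φ) (hf : φ.freeForN t i) :
    Ded Γ (φ.substN i t) :=
  mono (allNE (allNI h (by simp)) hf) (by simp)

/-- Instances of the Peano axioms. -/
theorem peano {α : AFm} (h : PeanoAx α) (t u : NTm) :
    ∃ j, j ∉ u.fv ∧ 1 < j ∧
      Ded Γ (((α.toS.substN 0 (.var j)).substN 1 u).substN j t) := by
  obtain ⟨j, hj⟩ := Infinite.exists_notMem_finset (u.fv ∪ {0, 1})
  have hff (v : NTm) (i i' i'' : ℕ) (v' v'' : NTm) : α.toS.freeForN v i ∧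
      (α.toS.substN i' v').freeForN v i ∧
      ((α.toS.substN i' v').substN i'' v'').freeForN v i := by
    induction h <;> simp [AFm.toS, AFm.neg, SFm.freeForN, SFm.substN]
  refine ⟨j, by simp_all, by simp_all; omega, ?_⟩
  refine substN j t (substN 1 u (substN 0 _ (ofProv (.extra (.inl (.peano h)) trivial)) ?_) ?_) ?_
  · exact (hff _ _ 0 0 .zero .zero).1
  · exact (hff _ _ _ 0 _ .zero).2.1
  · exact (hff _ _ _ _ _ _).2.2

theorem succNeZero {t : NTm} (h : Ded Γ (.eq (.add t .one) .zero)) : Ded Γ .bot := by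
  obtain ⟨j, hu, hj, h'⟩ := peano (Γ := Γ) .succ_ne_zero t .zero
  have : ¬ j = 1 := by omega
  simp [AFm.toS, AFm.neg, SFm.substN, NTm.subst, this] at h'
  exact mp h' h

theorem succInj {t u : NTm} (h : Ded Γ (.eq (.add t .one) (.add u .one))) : Ded Γ (.eq t u) := by
  obtain ⟨j, hu, hj, h'⟩ := peano (Γ := Γ) .succ_inj t u
  have : ¬ j = 1 := by omega
  simp [AFm.toS, SFm.substN, NTm.subst, this, NTm.subst_of_notMem _ hu] at h'
  exact mp h' h

theorem addZero (t : NTm) : Ded Γ (.eq (.add t .zero) t) := by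
  obtain ⟨j, hu, hj, h'⟩ := peano (Γ := Γ) .add_zero t .zero
  have : ¬ j = 1 := by omega
  simpa [AFm.toS, SFm.substN, NTm.subst, this] using h'

theorem mulZero (t : NTm) : Ded Γ (.eq (.mul t .zero) .zero) := by
  obtain ⟨j, hu, hj, h'⟩ := peano (Γ := Γ) .mul_zero t .zero
  have : ¬ j = 1 := by omega
  simpa [AFm.toS, SFm.substN, NTm.subst, this] using h'

theorem addSucc (t u : NTm) :
    Ded Γ (.eq (.add t (.add u .one)) (.add (.add t u) .one)) := by
  obtain ⟨j, hu, hj, h'⟩ := peano (Γ := Γ) .add_succ t u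
  have : ¬ j = 1 := by omega
  simpa [AFm.toS, SFm.substN, NTm.subst, this, NTm.subst_of_notMem _ hu] using h'

theorem mulSucc (t u : NTm) :
    Ded Γ (.eq (.mul t (.add u .one)) (.add (.mul t u) t)) := by
  obtain ⟨j, hu, hj, h'⟩ := peano (Γ := Γ) .mul_succ t u
  have : ¬ j = 1 := by omega
  simpa [AFm.toS, SFm.substN, NTm.subst, this, NTm.subst_of_notMem _ hu] using h'

/-- Induction, instantiated at a term. -/
theorem induct {φ : SFm} (i : ℕ) (t : NTm) (h0 : Ded [] (φ.substN i .zero))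
    (hs : Ded [φ] (φ.substN i (.add (.var i) .one))) (hf : φ.freeForN t i) :
    Ded Γ (φ.substN i t) := by
  refine mono (Γ := []) (allNE (mp (ofProv (.extra (.inl (.ind φ i)) trivial)) ?_) hf) (by simp)
  exact andI h0 (allNI (impI hs) (by simp))

end Ded

/-- Terms modulo equality provable from `Γ`. -/
def termSetoid (Γ : List SFm) : Setoid NTm where
  r t u := Ded Γ (.eq t u)
  iseqv := ⟨Ded.eqRefl, Ded.eqSymm, Ded.eqTrans⟩

/-- The Lindenbaum algebra of terms over `Γ`. -/
def TermAlg (Γ : List SFm) : Type := Quotient (termSetoid Γ)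

namespace TermAlg

variable {Γ : List SFm}

/-- The class of a term. -/
def mk (Γ : List SFm) (t : NTm) : TermAlg Γ := Quotient.mk (termSetoid Γ) t

theorem mk_eq {t u : NTm} : mk Γ t = mk Γ u ↔ Ded Γ (.eq t u) :=
  ⟨fun h => Quotient.exact h, fun h => Quotient.sound (s := termSetoid Γ) h⟩

instance : Zero (TermAlg Γ) := ⟨mk Γ .zero⟩
instance : One (TermAlg Γ) := ⟨mk Γ .one⟩
instance : Add (TermAlg Γ) :=
  ⟨Quotient.map₂ NTm.add fun _ _ h _ _ h' => Ded.eqAdd h h'⟩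
instance : Mul (TermAlg Γ) :=
  ⟨Quotient.map₂ NTm.mul fun _ _ h _ _ h' => Ded.eqMul h h'⟩

theorem mk_add (t u : NTm) : mk Γ (.add t u) = mk Γ t + mk Γ u := rfl
theorem mk_mul (t u : NTm) : mk Γ (.mul t u) = mk Γ t * mk Γ u := rfl
theorem mk_zero : mk Γ .zero = 0 := rfl
theorem mk_one : mk Γ .one = 1 := rfl

theorem mk_surjective (x : TermAlg Γ) : ∃ t, mk Γ t = x := Quotient.exists_rep x

theorem add_zero' (x : TermAlg Γ) : x + 0 = x := by
  obtain ⟨t, rfl⟩ := mk_surjective x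
  exact mk_eq.2 (Ded.addZero t)

theorem mul_zero' (x : TermAlg Γ) : x * 0 = 0 := by
  obtain ⟨t, rfl⟩ := mk_surjective x
  exact mk_eq.2 (Ded.mulZero t)

theorem add_succ' (x y : TermAlg Γ) : x + (y + 1) = (x + y) + 1 := by
  obtain ⟨t, rfl⟩ := mk_surjective x
  obtain ⟨u, rfl⟩ := mk_surjective y
  exact mk_eq.2 (Ded.addSucc t u)

theorem mul_succ' (x y : TermAlg Γ) : x * (y + 1) = x * y + x := by
  obtain ⟨t, rfl⟩ := mk_surjective x
  obtain ⟨u, rfl⟩ := mk_surjective y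
  exact mk_eq.2 (Ded.mulSucc t u)

/-- Proof of an equation between terms by induction on the variable `i`. -/
theorem induct {l r : NTm} (i : ℕ) (t : NTm)
    (h0 : ∀ Δ, mk Δ (l.subst i .zero) = mk Δ (r.subst i .zero))
    (hs : ∀ Δ, mk Δ l = mk Δ r →
      mk Δ (l.subst i (.add (.var i) .one)) = mk Δ (r.subst i (.add (.var i) .one))) :
    mk Γ (l.subst i t) = mk Γ (r.subst i t) := by
  refine mk_eq.2 (Ded.induct (φ := .eq l r) i t (mk_eq.1 (h0 _)) (mk_eq.1 (hs _ ?_)) ?_)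
  · exact mk_eq.2 (Ded.hyp (by simp))
  · simp [SFm.freeForN]

theorem zero_add' (x : TermAlg Γ) : 0 + x = x := by
  obtain ⟨t, rfl⟩ := mk_surjective x
  have := induct (Γ := Γ) (l := .add .zero (.var 0)) (r := .var 0) 0 t
    (by intro Δ; simp only [NTm.subst, if_true, mk_add, mk_zero, add_zero'])
    (by intro Δ h; simp_all only [NTm.subst, if_true, mk_add, mk_one, add_succ'])
  simpa only [NTm.subst, if_true, mk_add, mk_zero] using this

theorem add_assoc' (x y z : TermAlg Γ) : x + y + z = x + (y + z) := by
  obtain ⟨t, rfl⟩ := mk_surjective x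
  obtain ⟨u, rfl⟩ := mk_surjective y
  obtain ⟨v, rfl⟩ := mk_surjective z
  obtain ⟨j, ht, hu, -⟩ := NTm.exists_notMem_fv t u u
  have := induct (Γ := Γ) (l := .add (.add t u) (.var j)) (r := .add t (.add u (.var j))) j v
    (by intro Δ; simp only [NTm.subst, NTm.subst_of_notMem _ ht, NTm.subst_of_notMem _ hu, if_true,
          mk_add, mk_zero, add_zero'])
    (by intro Δ h; simp_all only [NTm.subst, NTm.subst_of_notMem _ ht, NTm.subst_of_notMem _ hu,
          if_true, mk_add, mk_one, add_succ'])
  simpa only [NTm.subst, NTm.subst_of_notMem _ ht, NTm.subst_of_notMem _ hu, if_true, mk_add]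
    using this

theorem succ_add' (x y : TermAlg Γ) : (x + 1) + y = (x + y) + 1 := by
  obtain ⟨t, rfl⟩ := mk_surjective x
  obtain ⟨v, rfl⟩ := mk_surjective y
  obtain ⟨j, ht, -, -⟩ := NTm.exists_notMem_fv t t t
  have := induct (Γ := Γ) (l := .add (.add t .one) (.var j)) (r := .add (.add t (.var j)) .one) j v
    (by intro Δ; simp only [NTm.subst, NTm.subst_of_notMem _ ht, if_true,
          mk_add, mk_zero, add_zero'])
    (by intro Δ h; simp_all only [NTm.subst, NTm.subst_of_notMem _ ht,
          if_true, mk_add, mk_one, add_succ'])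
  simpa only [NTm.subst, NTm.subst_of_notMem _ ht, if_true, mk_add, mk_one] using this

theorem add_comm' (x y : TermAlg Γ) : x + y = y + x := by
  obtain ⟨t, rfl⟩ := mk_surjective x
  obtain ⟨v, rfl⟩ := mk_surjective y
  obtain ⟨j, ht, -, -⟩ := NTm.exists_notMem_fv t t t
  have := induct (Γ := Γ) (l := .add t (.var j)) (r := .add (.var j) t) j v
    (by intro Δ; simp only [NTm.subst, NTm.subst_of_notMem _ ht, if_true,
          mk_add, mk_zero, add_zero', zero_add'])
    (by intro Δ h; simp_all only [NTm.subst, NTm.subst_of_notMem _ ht,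
          if_true, mk_add, mk_one, add_succ', succ_add'])
  simpa only [NTm.subst, NTm.subst_of_notMem _ ht, if_true, mk_add] using this

theorem mul_add' (x y z : TermAlg Γ) : x * (y + z) = x * y + x * z := by
  obtain ⟨t, rfl⟩ := mk_surjective x
  obtain ⟨u, rfl⟩ := mk_surjective y
  obtain ⟨v, rfl⟩ := mk_surjective z
  obtain ⟨j, ht, hu, -⟩ := NTm.exists_notMem_fv t u u
  have := induct (Γ := Γ) (l := .mul t (.add u (.var j)))
    (r := .add (.mul t u) (.mul t (.var j))) j v
    (by intro Δ; simp only [NTm.subst, NTm.subst_of_notMem _ ht, NTm.subst_of_notMem _ hu, if_true,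
          mk_add, mk_mul, mk_zero, mul_zero', add_zero'])
    (by intro Δ h
        simp_all only [NTm.subst, NTm.subst_of_notMem _ ht, NTm.subst_of_notMem _ hu,
          if_true, mk_add, mk_mul, mk_one, add_succ', mul_succ']
        rw [add_assoc'])
  simpa only [NTm.subst, NTm.subst_of_notMem _ ht, NTm.subst_of_notMem _ hu, if_true, mk_add,
    mk_mul] using this

theorem mul_assoc' (x y z : TermAlg Γ) : x * y * z = x * (y * z) := by
  obtain ⟨t, rfl⟩ := mk_surjective x
  obtain ⟨u, rfl⟩ := mk_surjective y
  obtain ⟨v, rfl⟩ := mk_surjective z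
  obtain ⟨j, ht, hu, -⟩ := NTm.exists_notMem_fv t u u
  have := induct (Γ := Γ) (l := .mul (.mul t u) (.var j)) (r := .mul t (.mul u (.var j))) j v
    (by intro Δ; simp only [NTm.subst, NTm.subst_of_notMem _ ht, NTm.subst_of_notMem _ hu, if_true,
          mk_mul, mk_zero, mul_zero'])
    (by intro Δ h
        simp_all only [NTm.subst, NTm.subst_of_notMem _ ht, NTm.subst_of_notMem _ hu,
          if_true, mk_add, mk_mul, mk_one, mul_succ']
        rw [mul_add'])
  simpa only [NTm.subst, NTm.subst_of_notMem _ ht, NTm.subst_of_notMem _ hu, if_true, mk_mul]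
    using this

theorem zero_mul' (x : TermAlg Γ) : 0 * x = 0 := by
  obtain ⟨t, rfl⟩ := mk_surjective x
  have := induct (Γ := Γ) (l := .mul .zero (.var 0)) (r := .zero) 0 t
    (by intro Δ; simp only [NTm.subst, if_true, mk_mul, mk_zero, mul_zero'])
    (by intro Δ h; simp_all only [NTm.subst, if_true, mk_add, mk_mul, mk_zero, mk_one, mul_succ',
          add_zero'])
  simpa only [NTm.subst, if_true, mk_mul, mk_zero, mk_one] using this

theorem one_mul' (x : TermAlg Γ) : 1 * x = x := by
  obtain ⟨t, rfl⟩ := mk_surjective x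
  have := induct (Γ := Γ) (l := .mul .one (.var 0)) (r := .var 0) 0 t
    (by intro Δ; simp only [NTm.subst, if_true, mk_mul, mk_zero, mul_zero'])
    (by intro Δ h; simp_all only [NTm.subst, if_true, mk_add, mk_mul, mk_one, mul_succ'])
  simpa only [NTm.subst, if_true, mk_mul, mk_zero, mk_one] using this

theorem succ_mul' (x y : TermAlg Γ) : (x + 1) * y = x * y + y := by
  obtain ⟨t, rfl⟩ := mk_surjective x
  obtain ⟨v, rfl⟩ := mk_surjective y
  obtain ⟨j, ht, -, -⟩ := NTm.exists_notMem_fv t t t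
  have := induct (Γ := Γ) (l := .mul (.add t .one) (.var j))
    (r := .add (.mul t (.var j)) (.var j)) j v
    (by intro Δ; simp only [NTm.subst, NTm.subst_of_notMem _ ht, if_true,
          mk_add, mk_mul, mk_zero, mul_zero', add_zero'])
    (by intro Δ h
        simp_all only [NTm.subst, NTm.subst_of_notMem _ ht,
          if_true, mk_add, mk_mul, mk_one, add_succ', mul_succ']
        exact congrArg (· + 1) (by rw [add_assoc', add_assoc', add_comm' (mk Δ t)]))
  simpa only [NTm.subst, NTm.subst_of_notMem _ ht, if_true, mk_add, mk_mul,
    mk_one] using this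

theorem mul_comm' (x y : TermAlg Γ) : x * y = y * x := by
  obtain ⟨t, rfl⟩ := mk_surjective x
  obtain ⟨v, rfl⟩ := mk_surjective y
  obtain ⟨j, ht, -, -⟩ := NTm.exists_notMem_fv t t t
  have := induct (Γ := Γ) (l := .mul t (.var j)) (r := .mul (.var j) t) j v
    (by intro Δ; simp only [NTm.subst, NTm.subst_of_notMem _ ht, if_true,
          mk_mul, mk_zero, mul_zero', zero_mul'])
    (by intro Δ h; simp_all only [NTm.subst, NTm.subst_of_notMem _ ht,
          if_true, mk_add, mk_mul, mk_one, mul_succ', succ_mul'])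
  simpa only [NTm.subst, NTm.subst_of_notMem _ ht, if_true, mk_mul] using this

instance : CommSemiring (TermAlg Γ) where
  add_assoc := add_assoc'
  zero_add := zero_add'
  add_zero := add_zero'
  add_comm := add_comm'
  nsmul := nsmulRec
  left_distrib := mul_add'
  right_distrib x y z := by rw [mul_comm', mul_add', mul_comm' z, mul_comm' z]
  zero_mul := zero_mul'
  mul_zero := mul_zero'
  mul_assoc := mul_assoc'
  one_mul := one_mul'
  mul_one x := by rw [mul_comm', one_mul']
  mul_comm := mul_comm'

theorem add_right_cancel' {x y z : TermAlg Γ} (h : x + z = y + z) : x = y := by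
  obtain ⟨t, rfl⟩ := mk_surjective x
  obtain ⟨u, rfl⟩ := mk_surjective y
  obtain ⟨v, rfl⟩ := mk_surjective z
  obtain ⟨j, ht, hu, -⟩ := NTm.exists_notMem_fv t u u
  have := Ded.induct (Γ := Γ) (φ := (SFm.eq (.add t (.var j)) (.add u (.var j))).imp (.eq t u)) j v
    (by
      simp only [SFm.substN, NTm.subst, NTm.subst_of_notMem _ ht, NTm.subst_of_notMem _ hu, if_true]
      refine Ded.impI (mk_eq.1 ?_)
      simpa only [mk_add, mk_zero, add_zero'] using mk_eq.2 (Ded.hyp (List.mem_singleton_self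
        (SFm.eq (.add t .zero) (.add u .zero)))))
    (by
      simp only [SFm.substN, NTm.subst, NTm.subst_of_notMem _ ht, NTm.subst_of_notMem _ hu, if_true]
      refine Ded.impI (Ded.mp (Ded.wk (Ded.hyp (List.mem_singleton_self _))) ?_)
      refine Ded.succInj (mk_eq.1 ?_)
      have := mk_eq.2 (Ded.hyp (List.mem_cons_self
        (a := (SFm.eq (.add t (.add (.var j) .one)) (.add u (.add (.var j) .one))))
        (l := [(SFm.eq (.add t (.var j)) (.add u (.var j))).imp (.eq t u)])))
      simpa only [mk_add, mk_one, add_succ'] using this)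
    (by simp [SFm.freeForN])
  simp only [SFm.substN, NTm.subst, NTm.subst_of_notMem _ ht, NTm.subst_of_notMem _ hu,
    if_true] at this
  exact mk_eq.2 (Ded.mp this (mk_eq.1 h))

instance : IsCancelAdd (TermAlg Γ) :=
  letI : IsRightCancelAdd (TermAlg Γ) := ⟨fun _ _ _ h => add_right_cancel' h⟩
  AddCommMagma.IsRightCancelAdd.toIsCancelAdd _

theorem bot_of_succ_eq_zero {x : TermAlg Γ} (h : x + 1 = 0) : Ded Γ .bot := by
  obtain ⟨t, rfl⟩ := mk_surjective x
  exact Ded.succNeZero (mk_eq.1 h)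

end TermAlg

/-! ### Order and the pairing function -/

theorem exists_fresh (s : Finset ℕ) (Γ : List SFm) (χ : SFm) :
    ∃ j, j ∉ s ∧ j ∉ χ.fvN ∧ ∀ γ ∈ Γ, j ∉ γ.fvN := by
  obtain ⟨j, hj⟩ := Infinite.exists_notMem_finset (s ∪ χ.fvN ∪ (conj Γ).fvN)
  simp only [Finset.mem_union, not_or] at hj
  refine ⟨j, hj.1.1, hj.1.2, ?_⟩
  have := hj.2
  clear hj
  induction Γ <;> simp_all [conj, SFm.fvN]

namespace TermAlg

open Ded

variable {Γ : List SFm} {χ : SFm}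

theorem mk_hyp {t u : NTm} (h : SFm.eq t u ∈ Γ) : mk Γ t = mk Γ u := mk_eq.2 (hyp h)

theorem mk_mono {Δ : List SFm} {t u : NTm} (h : mk Γ t = mk Γ u) (hs : Γ ⊆ Δ) :
    mk Δ t = mk Δ u :=
  mk_eq.2 ((mk_eq.1 h).mono hs)

theorem zero_cases (t : NTm) (h0 : ∀ Δ, Γ ⊆ Δ → mk Δ t = 0 → Ded Δ χ)
    (hs : ∀ Δ, Γ ⊆ Δ → ∀ k, mk Δ t = mk Δ (.var k) + 1 → Ded Δ χ) : Ded Γ χ := by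
  obtain ⟨k, hk, hχ, hΓ⟩ := exists_fresh t.fv Γ χ
  obtain ⟨i, hi⟩ := Infinite.exists_notMem_finset {k}
  have hik : ¬ i = k := by simpa using hi
  have hki : ¬ k = i := fun h => hik h.symm
  have := Ded.induct (Γ := Γ)
    (φ := (SFm.eq (.var i) .zero).or (.exN k (.eq (.var i) (.add (.var k) .one)))) i t
    (by
      simp only [SFm.substN, NTm.subst, if_true]
      exact orL (eqRefl _))
    (by
      simp only [SFm.substN, NTm.subst, if_true, hki, if_false]
      refine orR (exNI (t := .var i) ?_ (by simp [SFm.freeForN]))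
      simp only [SFm.substN, NTm.subst, if_true, hik, if_false]
      exact eqRefl _)
    (by simp [SFm.freeForN, hk])
  simp only [SFm.substN, NTm.subst, if_true, hki, if_false] at this
  refine orE this (h0 _ (by simp) (mk_hyp (by simp))) ?_
  refine cut (exNE (hyp List.mem_cons_self) ?_ hχ ?_) (hyp List.mem_cons_self)
  · exact hs _ (fun x hx => by simp [hx]) k (mk_hyp (by simp))
  · simpa [SFm.fvN, hk] using hΓ

theorem le_cases (t u : NTm)
    (h₁ : ∀ Δ, Γ ⊆ Δ → ∀ k, mk Δ t + mk Δ (.var k) = mk Δ u → Ded Δ χ)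
    (h₂ : ∀ Δ, Γ ⊆ Δ → ∀ k, mk Δ u + mk Δ (.var k) = mk Δ t → Ded Δ χ) : Ded Γ χ := by
  obtain ⟨k, hk, hχ, hΓ⟩ := exists_fresh (t.fv ∪ u.fv) Γ χ
  simp only [Finset.mem_union, not_or] at hk
  obtain ⟨hkt, hku⟩ := hk
  obtain ⟨i, hi⟩ := Infinite.exists_notMem_finset (insert k u.fv)
  simp only [Finset.mem_insert, not_or] at hi
  obtain ⟨hik, hiu⟩ := hi
  have hki : ¬ k = i := fun h => hik h.symm
  have hu := fun v => NTm.subst_of_notMem v hku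
  have hu' := fun v => NTm.subst_of_notMem v hiu
  have := Ded.induct (Γ := Γ)
    (φ := (SFm.exN k (.eq (.add (.var i) (.var k)) u)).or
      (.exN k (.eq (.add u (.var k)) (.var i)))) i t
    (by
      simp only [SFm.substN, NTm.subst, if_true, hki, if_false, hu']
      refine orL (exNI (t := u) ?_ (by simp [SFm.freeForN]))
      simp only [SFm.substN, NTm.subst, if_true, hu]
      exact mk_eq.1 (by simp [mk_add, mk_zero]))
    (by
      simp only [SFm.substN, NTm.subst, if_true, hki, if_false, hu']
      refine orE (hyp (List.mem_singleton_self _)) ?_ ?_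
      · refine exNE (i := k) (hyp List.mem_cons_self) ?_ (by simp [SFm.fvN]) (by simp [SFm.fvN])
        refine zero_cases (.var k) (fun Δ hΔ e₁ => ?_) fun Δ hΔ j e₁ => ?_
        · have e₂ := mk_hyp (hΔ List.mem_cons_self)
          refine orR (exNI (t := .one) ?_ (by simp [SFm.freeForN]))
          simp only [SFm.substN, NTm.subst, if_true, hu, hik, if_false]
          refine mk_eq.1 ?_
          simp only [mk_add] at e₂ ⊢
          rw [← e₂, e₁, add_zero]
        · have e₂ := mk_hyp (hΔ List.mem_cons_self)
          refine orL (exNI (t := .var j) ?_ (by simp [SFm.freeForN]))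
          simp only [SFm.substN, NTm.subst, if_true, hu, hik, if_false]
          refine mk_eq.1 ?_
          simp only [mk_add, mk_one] at e₂ ⊢
          rw [← e₂, e₁]
          ring
      · refine exNE (i := k) (hyp List.mem_cons_self) ?_ (by simp [SFm.fvN]) (by simp [SFm.fvN])
        refine orR (exNI (t := .add (.var k) .one) ?_ (by simp [SFm.freeForN]))
        simp only [SFm.substN, NTm.subst, if_true, hu, hik, if_false]
        refine mk_eq.1 ((fun Δ (e : mk Δ (.add u (.var k)) = mk Δ (.var i)) => ?_ :
          ∀ Δ, _ → mk Δ _ = mk Δ _) _ (mk_hyp List.mem_cons_self))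
        simp only [mk_add] at e ⊢
        rw [← e, add_assoc])
    (by simp [SFm.freeForN, hkt])
  simp only [SFm.substN, NTm.subst, if_true, hki, if_false, hu'] at this
  refine orE this ?_ ?_
  · refine cut (exNE (hyp List.mem_cons_self) ?_ hχ ?_) (hyp List.mem_cons_self)
    · exact h₁ _ (fun x hx => by simp [hx]) k (mk_hyp (by simp))
    · simpa [SFm.fvN, hkt, hku] using hΓ
  · refine cut (exNE (hyp List.mem_cons_self) ?_ hχ ?_) (hyp List.mem_cons_self)
    · exact h₂ _ (fun x hx => by simp [hx]) k (mk_hyp (by simp))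
    · simpa [SFm.fvN, hkt, hku] using hΓ

theorem double_cancel {t u : NTm} (h : mk Γ t + mk Γ t = mk Γ u + mk Γ u) : mk Γ t = mk Γ u := by
  have aux {Γ : List SFm} {t u : NTm} (k : ℕ) (h : mk Γ (.add t t) = mk Γ (.add u u))
      (hk : mk Γ (.add t (.var k)) = mk Γ u) : Ded Γ (.eq t u) := by
    refine zero_cases (.var k) (fun Δ hΔ e₁ => ?_) fun Δ hΔ j e₁ => ?_
    · have e₂ := mk_mono hk hΔ
      rw [mk_add, e₁, add_zero] at e₂
      exact mk_eq.1 e₂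
    · have e₂ := mk_mono hk hΔ
      have e₃ := mk_mono h hΔ
      simp only [mk_add] at e₂ e₃
      refine botE (bot_of_succ_eq_zero (x := mk Δ (.var j) + 1 + mk Δ (.var j)) ?_)
      rw [← e₂, e₁] at e₃
      apply add_left_cancel (a := mk Δ t + mk Δ t)
      rw [add_zero]
      refine Eq.trans ?_ e₃.symm
      ring
  refine mk_eq.2 (le_cases t u (fun Δ hΔ k hk => ?_) fun Δ hΔ k hk => ?_)
  · exact aux k (mk_mono h hΔ) hk
  · exact eqSymm (aux k (mk_mono h.symm hΔ) hk)

theorem pair_inj {w n m n' m' : NTm} (h : Ded Γ (pairEq w n m)) (h' : Ded Γ (pairEq w n' m')) :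
    Ded Γ ((SFm.eq n n').and (.eq m m')) := by
  have aux {Γ : List SFm} {n m n' m' : NTm} (k : ℕ) (h : Ded Γ (pairEq w n m))
      (h' : Ded Γ (pairEq w n' m')) (hk : mk Γ (.add (.add n m) (.var k)) = mk Γ (.add n' m')) :
      Ded Γ ((SFm.eq n n').and (.eq m m')) := by
    refine zero_cases (.var k) (fun Δ hΔ e₁ => ?_) fun Δ hΔ j e₁ => ?_
    · have e₂ := mk_mono hk hΔ
      have e₃ := mk_mono (mk_eq.2 h) hΔ
      have e₄ := mk_mono (mk_eq.2 h') hΔ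
      simp only [mk_add, mk_mul] at e₂ e₃ e₄
      rw [e₁, add_zero] at e₂
      rw [e₃, e₂] at e₄
      have e₅ := double_cancel (add_left_cancel e₄)
      rw [e₅] at e₂
      exact andI (mk_eq.1 (add_right_cancel e₂)) (mk_eq.1 e₅)
    · have e₂ := mk_mono hk hΔ
      have e₃ := mk_mono (mk_eq.2 h) hΔ
      have e₄ := mk_mono (mk_eq.2 h') hΔ
      simp only [mk_add, mk_mul, mk_one] at e₂ e₃ e₄
      rw [e₃, ← e₂, e₁] at e₄
      generalize mk Δ n = a at *
      generalize mk Δ m = b at *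
      generalize mk Δ m' = c at *
      generalize mk Δ (.var j) = d at *
      refine botE (bot_of_succ_eq_zero
        (x := a + a + 1 + d * (a + b + (d + 1) + 1 + (a + b + 1)) + c + c) ?_)
      apply add_left_cancel (a := (a + b) * (a + b + 1) + (b + b))
      rw [add_zero]
      refine Eq.trans ?_ e₄.symm
      ring
  refine le_cases (.add n m) (.add n' m') (fun Δ hΔ k hk => ?_) fun Δ hΔ k hk => ?_
  · exact aux k (h.mono hΔ) (h'.mono hΔ) hk
  · have := aux k (h'.mono hΔ) (h.mono hΔ) hk
    exact andI (eqSymm (andL this)) (eqSymm (andR this))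

theorem exists_double (t : NTm) (p : ℕ) (hp : p ∉ t.fv) :
    Ded Γ (.exN p (.eq (.add (.var p) (.var p)) (.mul t (.add t .one)))) := by
  obtain ⟨i, hi⟩ := Infinite.exists_notMem_finset {p}
  have hip : ¬ i = p := by simpa using hi
  have hpi : ¬ p = i := fun h => hip h.symm
  have := Ded.induct (Γ := Γ)
    (φ := .exN p (.eq (.add (.var p) (.var p)) (.mul (.var i) (.add (.var i) .one)))) i t
    (by
      simp only [SFm.substN, NTm.subst, if_true, hpi, if_false]
      refine exNI (t := .zero) ?_ (by simp [SFm.freeForN])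
      simp only [SFm.substN, NTm.subst, if_true]
      exact mk_eq.1 (by simp [mk_add, mk_mul, mk_zero]))
    (by
      simp only [SFm.substN, NTm.subst, if_true, hpi, if_false]
      refine exNE (hyp (List.mem_singleton_self _)) ?_ (by simp [SFm.fvN])
        (by simp [SFm.fvN])
      refine exNI (t := .add (.var p) (.add (.var i) .one)) ?_ (by simp [SFm.freeForN])
      simp only [SFm.substN, NTm.subst, if_true, hip, if_false]
      refine mk_eq.1 ((fun Δ (e : mk Δ (.add (.var p) (.var p)) =
        mk Δ (.mul (.var i) (.add (.var i) .one))) => ?_ : ∀ Δ, _ → mk Δ _ = mk Δ _) _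
          (mk_hyp List.mem_cons_self))
      simp only [mk_add, mk_mul, mk_one] at e ⊢
      rw [add_add_add_comm, e]
      ring)
    (by simp [SFm.freeForN, hp])
  simpa only [SFm.substN, NTm.subst, if_true, hpi, if_false] using this

theorem exists_pair (n m : NTm) (p : ℕ) (hn : p ∉ n.fv) (hm : p ∉ m.fv) :
    Ded Γ (.exN p (pairEq (.var p) n m)) := by
  refine mono (Γ := []) (exNE (exists_double (.add n m) p (by simp [NTm.fv, hn, hm])) ?_
    (by simp [SFm.fvN]) (by simp)) (by simp)
  have hn' := fun v => NTm.subst_of_notMem v hn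
  have hm' := fun v => NTm.subst_of_notMem v hm
  refine exNI (t := .add (.var p) m) ?_ (by simp [SFm.freeForN, pairEq])
  simp only [SFm.substN, NTm.subst, pairEq, if_true, hn', hm']
  refine mk_eq.1 ?_
  have e := mk_hyp (List.mem_singleton_self (SFm.eq (.add (.var p) (.var p))
    (.mul (.add n m) (.add (.add n m) .one))))
  simp only [mk_add, mk_mul, mk_one] at e ⊢
  rw [add_add_add_comm, e]

end TermAlg

/-! ### Substitution lemmas -/

theorem NTm.subst_self (t : NTm) (i : ℕ) : t.subst i (.var i) = t := by
  induction t <;> simp_all [NTm.subst]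

theorem NTm.subst_subst_cancel {t : NTm} {i j : ℕ} (h : j ∉ t.fv) :
    (t.subst i (.var j)).subst j (.var i) = t := by
  induction t <;> simp_all [NTm.subst, NTm.fv]
  split_ifs <;> simp_all [NTm.subst]
  grind

theorem NTm.mem_fv_subst_var {t : NTm} {i j v : ℕ} (h : v ∈ (t.subst i (.var j)).fv) :
    v = j ∨ (v ∈ t.fv ∧ v ≠ i) := by
  induction t with
  | var k =>
    simp only [NTm.subst] at h
    split_ifs at h <;> simp_all [NTm.fv]
  | _ => simp_all [NTm.subst, NTm.fv] <;> grind

namespace SFm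

/-- All numerical variables occurring in a formula, free or bound. -/
def occN : SFm → Finset ℕ
  | .bot => ∅
  | .eq t u => t.fv ∪ u.fv
  | .mem _ t _ => t.fv
  | .and φ ψ => φ.occN ∪ ψ.occN
  | .or φ ψ => φ.occN ∪ ψ.occN
  | .imp φ ψ => φ.occN ∪ ψ.occN
  | .allN i φ => insert i φ.occN
  | .exN i φ => insert i φ.occN
  | .allS _ _ φ => φ.occN
  | .exS _ _ φ => φ.occN

theorem fvN_subset_occN (φ : SFm) : φ.fvN ⊆ φ.occN := by
  induction φ <;> simp_all [fvN, occN] <;> grind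

theorem substN_self (φ : SFm) (i : ℕ) : φ.substN i (.var i) = φ := by
  induction φ <;> simp_all [substN, NTm.subst_self]

theorem freeForN_self (φ : SFm) (i : ℕ) : φ.freeForN (.var i) i := by
  induction φ <;> simp_all [freeForN, NTm.fv] <;> grind

theorem substN_of_notMem {φ : SFm} {i : ℕ} (t : NTm) (h : i ∉ φ.fvN) : φ.substN i t = φ := by
  induction φ <;> simp_all [substN, fvN, NTm.subst_of_notMem] <;> grind

theorem freeForN_of_notMem {φ : SFm} {i : ℕ} (t : NTm) (h : i ∉ φ.fvN) : φ.freeForN t i := by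
  induction φ <;> simp_all [freeForN, fvN]

theorem substN_substN_cancel {φ : SFm} {i j : ℕ} (h : j ∉ φ.occN) :
    (φ.substN i (.var j)).substN j (.var i) = φ := by
  induction φ with
  | allN k φ ih =>
    have := substN_of_notMem (φ := φ) (i := j) (.var i) (fun h' => h (by
      simp [occN, fvN_subset_occN φ h']))
    simp_all only [occN, substN, Finset.mem_insert, not_or]
    split_ifs <;> simp_all [substN] <;> grind
  | exN k φ ih =>
    have := substN_of_notMem (φ := φ) (i := j) (.var i) (fun h' => h (by
      simp [occN, fvN_subset_occN φ h']))
    simp_all only [occN, substN, Finset.mem_insert, not_or]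
    split_ifs <;> simp_all [substN] <;> grind
  | _ => simp_all [substN, occN, NTm.subst_subst_cancel]

theorem freeForN_substN {φ : SFm} {i j : ℕ} (h : j ∉ φ.occN) :
    (φ.substN i (.var j)).freeForN (.var i) j := by
  induction φ with
  | allN k φ ih =>
    have := fun (h' : j ∈ φ.fvN) => h (by simp [occN, fvN_subset_occN φ h'])
    simp_all only [occN, substN, Finset.mem_insert, not_or]
    split_ifs <;> simp_all [freeForN, NTm.fv]
  | exN k φ ih =>
    have := fun (h' : j ∈ φ.fvN) => h (by simp [occN, fvN_subset_occN φ h'])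
    simp_all only [occN, substN, Finset.mem_insert, not_or]
    split_ifs <;> simp_all [freeForN, NTm.fv]
  | _ => simp_all [substN, occN, freeForN]

theorem mem_fvN_substN_var {φ : SFm} {i j v : ℕ} (h : v ∈ (φ.substN i (.var j)).fvN) :
    v = j ∨ (v ∈ φ.fvN ∧ v ≠ i) := by
  induction φ with
  | bot => simp [substN, fvN] at h
  | eq t u =>
    simp only [substN, fvN, Finset.mem_union] at h ⊢
    have := @NTm.mem_fv_subst_var t i j v
    have := @NTm.mem_fv_subst_var u i j v
    grind
  | mem k t x => exact NTm.mem_fv_subst_var h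
  | allN k φ ih => simp only [substN] at h; split_ifs at h <;> simp_all [fvN]
  | exN k φ ih => simp only [substN] at h; split_ifs at h <;> simp_all [fvN]
  | _ => simp_all [substN, fvN] <;> grind

theorem fvS_substN (φ : SFm) (i : ℕ) (t : NTm) : (φ.substN i t).fvS = φ.fvS := by
  induction φ <;> simp_all [substN, fvS] <;> split_ifs <;> simp_all [fvS]

theorem noSetQ.substN {φ : SFm} (h : φ.noSetQ) (i : ℕ) (t : NTm) : (φ.substN i t).noSetQ := by
  induction φ <;> simp_all [SFm.substN, noSetQ] <;> split_ifs <;> simp_all [noSetQ]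

theorem noSetQ.substS {φ : SFm} (h : φ.noSetQ) (k i j : ℕ) : (φ.substS k i j).noSetQ := by
  induction φ <;> simp_all [SFm.substS, noSetQ] <;> split_ifs <;> simp_all [noSetQ]

theorem noSetQ.freeForS {φ : SFm} (h : φ.noSetQ) (k i j : ℕ) : φ.freeForS k i j := by
  induction φ <;> simp_all [SFm.freeForS, noSetQ]

theorem substS_self (φ : SFm) (k i : ℕ) : φ.substS k i i = φ := by
  induction φ <;> simp_all [substS]

theorem freeForS_self (φ : SFm) (k i : ℕ) : φ.freeForS k i i := by
  induction φ <;> simp_all [freeForS] <;> grind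

theorem fvN_substS (φ : SFm) (k i j : ℕ) : (φ.substS k i j).fvN = φ.fvN := by
  induction φ <;> simp_all [substS, fvN] <;> split_ifs <;> simp_all [fvN]

theorem occN_substS (φ : SFm) (k i j : ℕ) : (φ.substS k i j).occN = φ.occN := by
  induction φ <;> simp_all [substS, occN] <;> split_ifs <;> simp_all [occN]

theorem substS_substN (φ : SFm) (k i j v : ℕ) (t : NTm) :
    (φ.substN v t).substS k i j = (φ.substS k i j).substN v t := by
  induction φ <;> simp_all [substS, substN] <;> split_ifs <;> simp_all [substS, substN]

theorem noSetQ.substS_substS {φ : SFm} (h : φ.noSetQ) {k i j l : ℕ} (hj : (k, j) ∉ φ.fvS) :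
    (φ.substS k i j).substS k j l = φ.substS k i l := by
  induction φ with
  | mem =>
    simp_all only [SFm.substS, fvS]
    split_ifs <;> simp_all [SFm.substS]
    grind
  | _ => simp_all [SFm.substS, noSetQ, fvS]

theorem noSetQ.mem_fvS_substS {φ : SFm} (h : φ.noSetQ) {k i j : ℕ} {v : ℕ × ℕ}
    (hv : v ∈ (φ.substS k i j).fvS) : v = (k, j) ∨ (v ∈ φ.fvS ∧ v ≠ (k, i)) := by
  induction φ with
  | mem =>
    simp only [SFm.substS] at hv
    split_ifs at hv <;> simp_all [fvS]
  | allS | exS => exact h.elim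
  | allN _ _ ih | exN _ _ ih => exact ih h hv
  | and φ ψ h1 h2 | or φ ψ h1 h2 | imp φ ψ h1 h2 =>
    simp only [SFm.substS, fvS, Finset.mem_union] at hv ⊢
    have := h1 h.1
    have := h2 h.2
    grind
  | _ => simp [SFm.substS, fvS] at hv

end SFm

/-! ### Unique choice from `Δ¹₁`-comprehension -/

section pairEq

variable (t u v w : NTm) (k i j : ℕ)

theorem pairEq_substN :
    (pairEq t u v).substN i w = pairEq (t.subst i w) (u.subst i w) (v.subst i w) := rfl

theorem pairEq_substS : (pairEq t u v).substS k i j = pairEq t u v := rfl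

theorem freeForS_pairEq : (pairEq t u v).freeForS k i j := trivial

theorem freeForN_pairEq : (pairEq t u v).freeForN w i := trivial

theorem fvN_pairEq : (pairEq t u v).fvN = t.fv ∪ u.fv ∪ v.fv := by
  ext; simp [pairEq, SFm.fvN, NTm.fv]

theorem fvS_pairEq : (pairEq t u v).fvS = ∅ := rfl

end pairEq

/-- `x_{ix}` is the only set satisfying `A`. -/
def isUnique (A : ℕ → SFm) (ix iz q : ℕ) : SFm :=
  .allS 1 iz ((A iz).imp (.allN q ((SFm.mem 1 (.var q) ix).iff (.mem 1 (.var q) iz))))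

/-- `w` codes a pair `(n', m')` such that `m'` belongs to some set `x_{iz}` satisfying `B` at
`n'`. -/
def inGraph (B : ℕ → SFm) (n' m' iz : ℕ) (w : NTm) : SFm :=
  .exN n' (.exN m' ((pairEq w (.var n') (.var m')).and ((B iz).and (.mem 1 (.var m') iz))))

/-- `w` codes a pair, and if it codes `(n, m)` and `A` holds of `x_j` at `n`, then
`m` belongs to `x_j`. -/
def inGraphDual (A : ℕ → SFm) (n m j : ℕ) (w : NTm) : SFm :=
  (SFm.exN n (.exN m (pairEq w (.var n) (.var m)))).and
    (.allN n (.allN m ((pairEq w (.var n) (.var m)).imp ((A j).imp (.mem 1 (.var m) j)))))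

namespace Ded

variable {Γ : List SFm} {A B : ℕ → SFm} {n m n' m' w ix iz j q a : ℕ}

theorem allNE_self {φ : SFm} (h : Ded Γ (.allN a φ)) : Ded Γ φ := by
  simpa [SFm.substN_self] using allNE h (SFm.freeForN_self φ a)

theorem isUnique_elim (hA : (A iz).noSetQ) (hs : (A iz).substS 1 iz j = A j) (hx : iz ≠ ix)
    (hU : Ded Γ (isUnique A ix iz q)) (hj : Ded Γ (A j)) :
    Ded Γ ((SFm.mem 1 (.var a) ix).iff (.mem 1 (.var a) j)) := by
  have h := allSE (j := j) hU ⟨hA.freeForS _ _ _, by simp [SFm.freeForS, SFm.iff]⟩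
  simp only [SFm.substS, SFm.iff, hs, hx.symm] at h
  simpa [SFm.substN, SFm.iff, NTm.subst] using
    allNE (t := .var a) (mp h hj) (by simp [SFm.freeForN])

theorem inGraph_intro (hB : (B iz).noSetQ) (hs : (B iz).substS 1 iz j = B j)
    (hBn : (B j).substN n' (.var n) = A j) (hBf : (B j).freeForN (.var n) n')
    (hA : m' ∉ (A j).fvN) (hw : w ≠ n') (hw' : w ≠ m') (hnm : n' ≠ m') (hn : n ≠ m')
    (hp : Ded Γ (pairEq (.var w) (.var n) (.var m))) (hj : Ded Γ (A j))
    (hm : Ded Γ (.mem 1 (.var m) j)) : Ded Γ (.exS 1 iz (inGraph B n' m' iz (.var w))) := by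
  refine exSI (j := j) ?_ ?_
  · simp only [inGraph, pairEq, SFm.substS, hs, and_self, if_true]
    refine exNI (t := .var n) ?_ ?_
    · simp only [SFm.substN, hnm.symm, if_false, hBn]
      refine exNI (t := .var m) ?_ ?_
      · simp only [SFm.substN, SFm.substN_of_notMem _ hA]
        simpa [pairEq, NTm.subst, hw, hw', hnm, hnm.symm, hn] using andI hp (andI hj hm)
      · simp [SFm.freeForN, SFm.freeForN_of_notMem _ hA]
    · simp [SFm.freeForN, hBf, NTm.fv, hn.symm]
  · simp [inGraph, SFm.freeForS, pairEq, hB.freeForS]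

theorem inGraph_elim (hBn : (B j).substN n' (.var n) = A j) (hBf : (B j).freeForN (.var n) n')
    (hp : Ded Γ (pairEq (.var w) (.var n) (.var m)))
    (hp' : Ded Γ (pairEq (.var w) (.var n') (.var m')))
    (hj : Ded Γ (B j)) (hm : Ded Γ (.mem 1 (.var m') j)) :
    Ded Γ (A j) ∧ Ded Γ (.mem 1 (.var m) j) := by
  have h := TermAlg.pair_inj hp' hp
  constructor
  · rw [← hBn]
    exact eqRw n' h.andL (by rwa [SFm.substN_self]) (SFm.freeForN_self _ _) hBf
  · have := eqRw (φ := .mem 1 (.var 0) j) 0 h.andR (by simpa [SFm.substN, NTm.subst] using hm)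
      (by simp [SFm.freeForN]) (by simp [SFm.freeForN])
    simpa [SFm.substN, NTm.subst] using this

end Ded

/-- The hypothesis of unique choice for `A`. -/
def uniqueEx (A : ℕ → SFm) (n ix iz q : ℕ) : SFm :=
  .allN n (.exS 1 ix ((A ix).and (isUnique A ix iz q)))

/-- Side conditions: `A j` and `B j` express one property of the set `x_j`
at `n` and at `n'` respectively, and the remaining variables are fresh. -/
structure Fresh (A B : ℕ → SFm) (n m q n' m' w ix iz j : ℕ) : Prop where
  noSetQA : ∀ i, (A i).noSetQ
  noSetQB : ∀ i, (B i).noSetQ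
  substA : ∀ i, (A iz).substS 1 iz i = A i
  substA' : ∀ i, (A j).substS 1 j i = A i
  substB : ∀ i, (B iz).substS 1 iz i = B i
  substN : ∀ i, (B i).substN n' (.var n) = A i
  freeForN : ∀ i, (B i).freeForN (.var n) n'
  fvA : ∀ i, ∀ v ∈ ({m, q, n', m', w} : Finset ℕ), v ∉ (A i).fvN
  fvB : ∀ i, ∀ v ∈ ({n, m, q, m', w} : Finset ℕ), v ∉ (B i).fvN
  fvSA : ∀ i, ∀ v ∈ ({ix, iz, j} : Finset ℕ), v ≠ i → (1, v) ∉ (A i).fvS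
  fvSB : ∀ i, ∀ v ∈ ({ix, iz, j} : Finset ℕ), v ≠ i → (1, v) ∉ (B i).fvS
  iz_ne_ix : iz ≠ ix
  j_ne_ix : j ≠ ix
  j_ne_iz : j ≠ iz
  m_ne_n : m ≠ n
  distinct : n' ∉ ({n, m, q} : Finset ℕ) ∧ m' ∉ ({n, m, q, n'} : Finset ℕ) ∧
    w ∉ ({n, m, q, n', m'} : Finset ℕ)

namespace Fresh

open Ded

variable {A B : ℕ → SFm} {n m q n' m' w ix iz j : ℕ}

theorem intro {Γ : List SFm} (h : Fresh A B n m q n' m' w ix iz j) {i p : ℕ}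
    (hpn : p ≠ n') (hpm : p ≠ m') (hp : Ded Γ (pairEq (.var p) (.var n) (.var m)))
    (hi : Ded Γ (A i)) (hm : Ded Γ (.mem 1 (.var m) i)) :
    Ded Γ (.exS 1 iz (inGraph B n' m' iz (.var p))) := by
  have := h.distinct
  simp only [Finset.mem_insert, Finset.mem_singleton, not_or] at this
  exact inGraph_intro (h.noSetQB _) (h.substB i) (h.substN i) (h.freeForN i)
    (h.fvA i m' (by simp)) hpn hpm (by grind) (by grind) hp hi hm

theorem notMem_fvN_uniqueEx (h : Fresh A B n m q n' m' w ix iz j) :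
    ∀ v ∈ ({n, m, n', m', w} : Finset ℕ), v ∉ (uniqueEx A n ix iz q).fvN := by
  have := h.fvA
  simp only [Finset.mem_insert, Finset.mem_singleton, forall_eq_or_imp, forall_eq] at *
  simp [uniqueEx, isUnique, SFm.fvN, SFm.iff, NTm.fv]
  grind

theorem notMem_fvS_uniqueEx (h : Fresh A B n m q n' m' w ix iz j) :
    ∀ v ∈ ({ix, iz, j} : Finset ℕ), (1, v) ∉ (uniqueEx A n ix iz q).fvS := by
  have := h.fvSA
  have := h.j_ne_ix
  have := h.j_ne_iz
  simp only [Finset.mem_insert, Finset.mem_singleton, forall_eq_or_imp, forall_eq] at *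
  simp [uniqueEx, isUnique, SFm.fvS, SFm.iff]
  grind

theorem exists_of_uniqueEx {Γ : List SFm} {χ : SFm} (h : Fresh A B n m q n' m' w ix iz j)
    (hU : uniqueEx A n ix iz q ∈ Γ)
    (h' : ∀ Δ, Γ ⊆ Δ → Ded Δ (A ix) → (∀ i a, Ded Δ (A i) → Ded Δ
      ((SFm.mem 1 (.var a) ix).iff (.mem 1 (.var a) i))) → Ded Δ χ)
    (hχ : (1, ix) ∉ χ.fvS) (hΓ : ∀ γ ∈ Γ, (1, ix) ∉ γ.fvS) : Ded Γ χ := by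
  refine exSE (allNE_self (hyp hU)) (h' _ (List.subset_cons_self _ _) (hyp List.mem_cons_self).andL
    fun i a hi => ?_) hχ hΓ
  exact isUnique_elim (h.noSetQA _) (h.substA _) h.iz_ne_ix (hyp List.mem_cons_self).andR hi

theorem inGraph_iff (h : Fresh A B n m q n' m' w ix iz j) :
    Ded [uniqueEx A n ix iz q] (.allN w ((SFm.allS 1 j (inGraphDual A n m j (.var w))).iff
      (.exS 1 iz (inGraph B n' m' iz (.var w))))) := by
  have hN := h.notMem_fvN_uniqueEx
  have hS := h.notMem_fvS_uniqueEx
  obtain ⟨hA, hB, sA, sA', sB, sN, fN, fvA, fvB, fvSA, fvSB, zx, jx, jz, mn, d⟩ := id h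
  simp only [Finset.mem_insert, Finset.mem_singleton, not_or, forall_eq_or_imp, forall_eq] at *
  refine allNI (iffI ?_ ?_) (by simp [hN])
  · have h0 := allSE (j := ix) (hyp (List.mem_cons_self
      (a := SFm.allS 1 j (inGraphDual A n m j (.var w))) (l := [uniqueEx A n ix iz q])))
      (by simp [inGraphDual, SFm.freeForS, freeForS_pairEq, (hA _).freeForS])
    simp only [inGraphDual, pairEq_substS, SFm.substS, sA', and_self, if_true] at h0
    refine exNE h0.andL (exNE (hyp List.mem_cons_self) ?_ ?_ ?_) ?_ ?_
    · refine exists_of_uniqueEx h (by simp) (fun Δ hΔ h₁ h₂ => ?_) ?_ ?_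
      · have hp := (hyp (List.mem_cons_self)).mono hΔ
        refine h.intro (by grind) (by grind) hp h₁
          (mp (mp (allNE_self (allNE_self (h0.andR.mono
            fun _ hx => hΔ (List.mem_cons_of_mem _ (List.mem_cons_of_mem _ hx))))) hp) h₁)
      · simp [inGraph, SFm.fvS, fvS_pairEq]; grind
      · simp [inGraphDual, SFm.fvS, fvS_pairEq]; grind
    · simp [inGraph, SFm.fvN, fvN_pairEq, NTm.fv]; grind
    · simp [inGraphDual, SFm.fvN, fvN_pairEq, NTm.fv]; grind
    · simp [inGraph, SFm.fvN, fvN_pairEq, NTm.fv]; grind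
    · simp [inGraphDual, SFm.fvN, fvN_pairEq, NTm.fv]; grind
  · refine exSE (hyp List.mem_cons_self) (exNE (hyp List.mem_cons_self)
      (exNE (hyp List.mem_cons_self) (allSI ?_ ?_) ?_ ?_) ?_ ?_) ?_ ?_
    · refine andI (exNI (t := .var n') ?_ ?_)
        (allNI (allNI (impI (impI (exists_of_uniqueEx h (by simp) (fun Δ hΔ h₁ h₂ => ?_) ?_ ?_)))
          ?_) ?_)
      · simp only [SFm.substN, mn, if_false, pairEq_substN]
        refine exNI (t := .var m') ?_ (by simp [freeForN_pairEq])
        simp only [pairEq_substN, NTm.subst, mn, d, if_true, if_false]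
        exact (hyp List.mem_cons_self).andL
      · simp [SFm.freeForN, freeForN_pairEq, NTm.fv]
        grind
      · have hw := (hyp (List.mem_cons_of_mem _ (List.mem_cons_of_mem _ (List.mem_cons_self)))).mono
          hΔ
        obtain ⟨h₃, h₄⟩ := inGraph_elim (sN iz) (fN iz)
          ((hyp (List.mem_cons_of_mem _ List.mem_cons_self)).mono hΔ) hw.andL hw.andR.andL
          hw.andR.andR
        exact mp (h₂ j m ((hyp List.mem_cons_self).mono hΔ)).andL (mp (h₂ iz m h₃).andR h₄)
      · simp [SFm.fvS]; grind
      · simp [inGraph, SFm.fvS, fvS_pairEq]; grind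
      · simp [inGraph, SFm.fvN, fvN_pairEq, NTm.fv]; grind
      · simp [inGraph, SFm.fvN, fvN_pairEq, NTm.fv]; grind
    · simp [inGraph, SFm.fvS, fvS_pairEq]; grind
    · simp [inGraphDual, SFm.fvN, fvN_pairEq, NTm.fv]; grind
    · simp [inGraph, SFm.fvN, fvN_pairEq, NTm.fv]; grind
    · simp [inGraphDual, SFm.fvN, fvN_pairEq, NTm.fv]; grind
    · simp [inGraph, SFm.fvN, fvN_pairEq, NTm.fv]; grind
    · simp [inGraphDual, SFm.fvS, fvS_pairEq]; grind
    · simp [inGraph, SFm.fvS, fvS_pairEq]; grind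

theorem unique_choice (h : Fresh A B n m q n' m' w ix iz j) {iy p : ℕ}
    (hyA : ∀ i, iy ≠ i → (1, iy) ∉ (A i).fvS) (hyB : ∀ i, iy ≠ i → (1, iy) ∉ (B i).fvS)
    (yx : iy ≠ ix) (yz : iy ≠ iz) (yj : iy ≠ j)
    (hpA : ∀ i, p ∉ (A i).fvN) (hpB : ∀ i, p ∉ (B i).fvN)
    (hp : p ∉ ({n, m, n', m', w} : Finset ℕ)) :
    Ded [uniqueEx A n ix iz q] (.exS 1 iy (.allN n (.exS 1 ix ((A ix).and
      (.allN m ((SFm.mem 1 (.var m) ix).iff (pairMem 1 (.var n) (.var m) iy p))))))) := by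
  have hN := h.notMem_fvN_uniqueEx
  have hS := h.notMem_fvS_uniqueEx
  obtain ⟨hA, hB, sA, sA', sB, sN, fN, fvA, fvB, fvSA, fvSB, zx, jx, jz, mn, d⟩ := id h
  simp only [Finset.mem_insert, Finset.mem_singleton, not_or, forall_eq_or_imp, forall_eq] at *
  have hyH : (1, iy) ∉ (uniqueEx A n ix iz q).fvS := by
    simp [uniqueEx, isUnique, SFm.fvS, SFm.iff]
    grind
  have hpH : p ∉ (uniqueEx A n ix iz q).fvN := by
    simp [uniqueEx, isUnique, SFm.fvN, SFm.iff, NTm.fv]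
    grind
  have hd : Prov ((SFm.allN w ((SFm.allS 1 j (inGraphDual A n m j (.var w))).iff
      (.exS 1 iz (inGraph B n' m' iz (.var w))))).imp
        (.exS 1 iy (.allN w ((SFm.mem 1 (.var w) iy).iff
          (.exS 1 iz (inGraph B n' m' iz (.var w))))))) := by
    refine .extra (.inr (.intro _ _ _ _ _ _ ?_ ?_ ?_ ?_ yz yj)) trivial
    · simp [inGraphDual, SFm.noSetQ, pairEq, hA]
    · simp [inGraph, SFm.noSetQ, pairEq, hB]
    · simp [inGraphDual, SFm.fvS, fvS_pairEq]
      grind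
    · simp [inGraph, SFm.fvS, fvS_pairEq]
      grind
  refine exSE (mp (ofProv hd) h.inGraph_iff) (exSI (j := iy) ?_ (SFm.freeForS_self _ _ _))
    (by simp [SFm.fvS]) (by simpa using hyH)
  rw [SFm.substS_self]
  set Y := SFm.allN w ((SFm.mem 1 (.var w) iy).iff (.exS 1 iz (inGraph B n' m' iz (.var w))))
    with hY
  have YN : ∀ v, v ∉ (B iz).fvN ∨ v = n' → v ∉ Y.fvN := by
    simp [Y, inGraph, SFm.iff, SFm.fvN, fvN_pairEq, NTm.fv]
    grind
  have YS : ∀ v, v ≠ iy → v = ix ∨ v = iz → (1, v) ∉ Y.fvS := by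
    simp [Y, inGraph, SFm.iff, SFm.fvS, fvS_pairEq]
    grind
  have hYp {Γ : List SFm} (hΓ : Y ∈ Γ) : Ded Γ ((SFm.mem 1 (.var p) iy).iff
      (.exS 1 iz (inGraph B n' m' iz (.var p)))) := by
    have hw : ∀ i, SFm.substN (B i) w (.var p) = B i := fun i =>
      SFm.substN_of_notMem _ (fvB i).2.2.2.2
    have hw' : SFm.freeForN (.var p) w (B iz) := SFm.freeForN_of_notMem _ (fvB iz).2.2.2.2
    have := allNE (t := .var p) (hyp hΓ) (by
      simp [SFm.iff, inGraph, SFm.freeForN, freeForN_pairEq, NTm.fv, hw']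
      grind)
    have e1 : ¬ n' = w := by grind
    have e2 : ¬ m' = w := by grind
    simpa [SFm.iff, SFm.substN, inGraph, pairEq_substN, NTm.subst, hw, e1, e2] using this
  refine allNI (exSE (allNE_self (a := n) (hyp (φ := uniqueEx A n ix iz q) (by simp))) (exSI (j := ix) ?_
    (SFm.freeForS_self _ _ _)) ?_ ?_) ?_
  · rw [SFm.substS_self]
    set U := (A ix).and (isUnique A ix iz q) with hU
    have UN : ∀ v, (∀ i, v ∉ (A i).fvN) → v ∉ U.fvN := by
      simp [U, isUnique, SFm.iff, SFm.fvN, NTm.fv]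
      grind
    have US : (1, iz) ∉ U.fvS := by
      simp [U, isUnique, SFm.iff, SFm.fvS]
      grind
    have hu {Γ : List SFm} (hΓ : U ∈ Γ) {i a : ℕ} (hi : Ded Γ (A i)) :
        Ded Γ ((SFm.mem 1 (.var a) ix).iff (.mem 1 (.var a) i)) :=
      isUnique_elim (hA iz) (sA i) zx (hyp hΓ).andR hi
    refine andI (hyp List.mem_cons_self).andL (allNI (iffI ?_ ?_) ?_)
    · refine exNE (TermAlg.exists_pair (.var n) (.var m) p ?_ ?_) (exNI (t := .var p) ?_
        (SFm.freeForN_self _ _)) ?_ ?_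
      · simpa [NTm.fv] using hp.1
      · simpa [NTm.fv] using hp.2.1
      · rw [SFm.substN_self]
        have hp' := hyp (List.mem_cons_self (a := pairEq (.var p) (.var n) (.var m))
          (l := [SFm.mem 1 (.var m) ix, U, Y, uniqueEx A n ix iz q]))
        exact andI hp' (mp (hYp (by simp)).andR (h.intro hp.2.2.1 hp.2.2.2.1 hp'
          (hyp (φ := U) (by simp)).andL (hyp (by simp))))
      · simp [SFm.fvN, pairMem]
      · simp [SFm.fvN, NTm.fv, hp]
        grind
    · refine exNE (hyp List.mem_cons_self) (exSE (mp (hYp (by simp)).andL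
        (hyp List.mem_cons_self).andR) (exNE (hyp List.mem_cons_self)
        (exNE (hyp List.mem_cons_self) ?_ ?_ ?_) ?_ ?_) ?_ ?_) ?_ ?_
      · suffices ∀ Γ, (pairEq (.var p) (.var n) (.var m)).and (.mem 1 (.var p) iy) ∈ Γ →
            (pairEq (.var p) (.var n') (.var m')).and ((B iz).and (.mem 1 (.var m') iz)) ∈ Γ →
            U ∈ Γ → Ded Γ (.mem 1 (.var m) ix) from this _ (by simp) (by simp) (by simp)
        intro Γ hΓ hΓ' hUΓ
        obtain ⟨h₃, h₄⟩ := inGraph_elim (sN iz) (fN iz) (hyp hΓ).andL (hyp hΓ').andL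
          (hyp hΓ').andR.andL (hyp hΓ').andR.andR
        exact mp (hu hUΓ h₃).andR h₄
      · simp [SFm.fvN, NTm.fv]
        grind
      · simp [SFm.fvN, inGraph, pairMem, fvN_pairEq, NTm.fv]
        grind
      · simp [SFm.fvN, NTm.fv]
        grind
      · simp [SFm.fvN, inGraph, pairMem, fvN_pairEq, NTm.fv]
        grind
      · simp [SFm.fvS]
        grind
      · simp [SFm.fvS, pairMem, fvS_pairEq]
        grind
      · simp [SFm.fvN, NTm.fv]
        grind
      · simp [SFm.fvN, pairMem]
        grind
    · simp
      grind
  · simp [SFm.fvS]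
  · simp
    grind
  · simp
    grind

end Fresh

/-- (AC!) is derivable from `Δ¹₁`-comprehension. -/
theorem ACBang.prov {φ : SFm} (h : ACBang φ) : Prov φ := by
  obtain ⟨φ, n, ix, iz, iy, q, m, p, hφ, hiz, hizx, hiy, hiyx, hiyz, hq, hm, hp⟩ := h
  obtain ⟨n', hn'⟩ := Infinite.exists_notMem_finset (φ.occN ∪ {n, m, q, p})
  obtain ⟨m', hm'⟩ := Infinite.exists_notMem_finset (φ.occN ∪ {n, m, q, p, n'})
  obtain ⟨w, hw⟩ := Infinite.exists_notMem_finset (φ.occN ∪ {n, m, q, p, n', m'})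
  obtain ⟨j, hj⟩ := Infinite.exists_notMem_finset (φ.fvS.image Prod.snd ∪ {ix, iz, iy})
  have hjφ : (1, j) ∉ φ.fvS := fun h' => hj (by
    simp only [Finset.mem_union, Finset.mem_image]; exact .inl ⟨_, h', rfl⟩)
  have hsub := φ.fvN_subset_occN
  simp only [Finset.mem_union, Finset.mem_insert, Finset.mem_singleton, not_or] at hn' hm' hw hj
  have hBN (i v) (hv : v ∈ ((φ.substS 1 ix i).substN n (.var n')).fvN) :
      v = n' ∨ (v ∈ φ.fvN ∧ v ≠ n) := by
    simpa [SFm.fvN_substS] using SFm.mem_fvN_substN_var hv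
  have hAS (i : ℕ) (v : ℕ × ℕ) (hv : v ∈ (φ.substS 1 ix i).fvS) := hφ.mem_fvS_substS hv
  have hF : Fresh (fun i => φ.substS 1 ix i) (fun i => (φ.substS 1 ix i).substN n (.var n'))
      n m q n' m' w ix iz j := {
    noSetQA := fun i => hφ.substS _ _ _
    noSetQB := fun i => (hφ.substS _ _ _).substN _ _
    substA := fun i => hφ.substS_substS hiz
    substA' := fun i => hφ.substS_substS hjφ
    substB := fun i => by simp only [SFm.substS_substN, hφ.substS_substS hiz]
    substN := fun i => SFm.substN_substN_cancel (by simpa [SFm.occN_substS] using hn'.1)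
    freeForN := fun i => SFm.freeForN_substN (by simpa [SFm.occN_substS] using hn'.1)
    fvA := fun i v hv => by simp only [SFm.fvN_substS]; grind
    fvB := fun i v hv h' => by have := hBN i v h'; grind
    fvSA := fun i v hv hvi h' => by have := hAS i _ h'; grind
    fvSB := fun i v hv hvi h' => by rw [SFm.fvS_substN] at h'; have := hAS i _ h'; grind
    iz_ne_ix := hizx
    j_ne_ix := by grind
    j_ne_iz := by grind
    m_ne_n := hm.2
    distinct := by grind }
  have := hF.unique_choice (iy := iy) (p := p)
    (fun i hi h' => by have := hAS i _ h'; grind)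
    (fun i hi h' => by rw [SFm.fvS_substN] at h'; have := hAS i _ h'; grind)
    hiyx hiyz (by grind) (fun i => by simp only [SFm.fvN_substS]; grind)
    (fun i h' => by have := hBN i _ h'; grind) (by grind)
  simp only [uniqueEx, isUnique, SFm.substS_self] at this
  exact (Ded.impI this).toProv

theorem ACBang.arProv {φ : SFm} (h : ACBang φ) (hL : φ.sortLE 1) : ArProv DeltaC φ := by
  simpa [SFm.collapse_eq_self hL] using h.prov.collapse

/-- **Theorem 6.2 of the paper**: `Ar + (AC!)` is a sub-theory of `Ar + (Δ¹₁-C)`: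
the unique-choice scheme (AC!) is derivable in Ar extended with the
`Δ¹₁`-comprehension scheme; consequently every theorem of `Ar + (AC!)` is a
theorem of `Ar + (Δ¹₁-C)`. -/
theorem ACBang_subtheory_of_DeltaC :
    (∀ φ : SFm, ACBang φ → φ.sortLE 1 → ArProv DeltaC φ) ∧
    (∀ φ : SFm, ArProv ACBang φ → ArProv DeltaC φ) := by
  refine ⟨fun φ h hL => h.arProv hL, fun φ h => ?_⟩
  induction h with
  | axm h hL => exact .axm h hL
  | extra h hL => exact h.elim (fun h => .extra (.inl h) hL) fun h => h.arProv hL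
  | mp _ _ h h' => exact .mp h h'
  | allRN _ hi hL h => exact .allRN h hi hL
  | exRN _ hi hL h => exact .exRN h hi hL
  | allRS _ hi hL h => exact .allRS h hi hL
  | exRS _ hi hL h => exact .exRS h hi hL

end ArXiv150408062
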